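/- arXiv:2212.02393 — 6 statements merged into one kernel-verified Lean document; each statement's English description precedes it below -/
import Mathlib

section
/- For any non-empty perfect compact set X ⊆ ℝⁿ, where n ≥ 2, there exists a homeomorphism F : ℝⁿ → ℝⁿ of ℝⁿ onto itself such that F(X) ⊆ Iⁿ and F(X) ∩ ∂Iⁿ = {0}^{n−1} × 𝒞, where 𝒞 ⊆ [0,1] is the middle-thirds Cantor set. -/
open Set Topology Metric

noncomputable section

/-- The coordinate line `ℝ × {0}^{n-1}` in `ℝⁿ`. -/
def coordLine (n : ℕ) : Set (EuclideanSpace ℝ (Fin n)) :=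
  {x | ∀ i : Fin n, (i : ℕ) ≠ 0 → x i = 0}

/-- The coordinate hyperplane `ℝ^{n-1} × {0}` in `ℝⁿ`. -/
def coordHyperplane (n : ℕ) : Set (EuclideanSpace ℝ (Fin n)) :=
  {x | ∀ i : Fin n, (i : ℕ) = n - 1 → x i = 0}

/-- `X` can be ambiently embedded in `Y`: some self-homeomorphism of `ℝⁿ` takes `X` into `Y`. -/
def AmbientlyEmbeds {n : ℕ} (X Y : Set (EuclideanSpace ℝ (Fin n))) : Prop :=
  ∃ h : EuclideanSpace ℝ (Fin n) ≃ₜ EuclideanSpace ℝ (Fin n), h '' X ⊆ Y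

/-- `X` and `Y` are ambiently incomparable. -/
def AmbientlyIncomparable {n : ℕ} (X Y : Set (EuclideanSpace ℝ (Fin n))) : Prop :=
  ¬ AmbientlyEmbeds X Y ∧ ¬ AmbientlyEmbeds Y X

/-- `X ⊆ ℝⁿ` is locally hyperplanar at `x ∈ X`. -/
def LocallyHyperplanarAt {n : ℕ} (X : Set (EuclideanSpace ℝ (Fin n)))
    (x : EuclideanSpace ℝ (Fin n)) : Prop :=
  ∃ U ∈ 𝓝 x, ∃ h : U → EuclideanSpace ℝ (Fin n), Topology.IsEmbedding h ∧
    ∀ y : U, (y : EuclideanSpace ℝ (Fin n)) ∈ X → h y ∈ coordHyperplane n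

/-- A compact zero-dimensional set `K ⊆ ℝⁿ` is tame if a self-homeomorphism of `ℝⁿ`
moves it into the coordinate line. -/
def TameSet {n : ℕ} (K : Set (EuclideanSpace ℝ (Fin n))) : Prop :=
  ∃ h : EuclideanSpace ℝ (Fin n) ≃ₜ EuclideanSpace ℝ (Fin n), h '' K ⊆ coordLine n

/-- `K` is locally tame at `x`. -/
def LocallyTameAt {n : ℕ} (K : Set (EuclideanSpace ℝ (Fin n)))
    (x : EuclideanSpace ℝ (Fin n)) : Prop :=
  ∃ U ∈ 𝓝 x, TameSet (K ∩ closure U)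

/-- `K` is everywhere wild: locally wild at each of its points. -/
def EverywhereWild {n : ℕ} (K : Set (EuclideanSpace ℝ (Fin n))) : Prop :=
  ∀ x ∈ K, ¬ LocallyTameAt K x

/-- `K` is a Cantor set: homeomorphic to the middle-thirds Cantor set. -/
def IsCantorSet {X : Type*} [TopologicalSpace X] (K : Set X) : Prop :=
  Nonempty (↥K ≃ₜ ↥cantorSet)

/-- The unit cube `Iⁿ = [0,1]ⁿ` in `ℝⁿ`. -/
def unitCube (n : ℕ) : Set (EuclideanSpace ℝ (Fin n)) :=
  {x | ∀ i, x i ∈ Set.Icc (0 : ℝ) 1}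

/-- The open face `(0,1)^{n-1} × {0}` of the unit cube. -/
def openFace (n : ℕ) : Set (EuclideanSpace ℝ (Fin n)) :=
  {x | (∀ i : Fin n, (i : ℕ) < n - 1 → x i ∈ Set.Ioo (0 : ℝ) 1) ∧
    ∀ i : Fin n, (i : ℕ) = n - 1 → x i = 0}

/-- Two points of a planar set `G` whose first coordinates enclose a gap of the projection of `G`,
together with a point `(t, y)` of the segment joining them. -/
def InterpolatesAt (G : Set (ℝ × ℝ)) (t y : ℝ) : Prop :=
  ∃ p ∈ G, ∃ q ∈ G, p.1 ≤ t ∧ t ≤ q.1 ∧ p.2 ≤ y ∧ y ≤ q.2 ∧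
    (∀ s ∈ G, s.1 ≤ p.1 ∨ q.1 ≤ s.1) ∧
    (y - p.2) * (q.1 - p.1) = (t - p.1) * (q.2 - p.2)

theorem InterpolatesAt.lt {G : Set (ℝ × ℝ)} (hG : ∀ p ∈ G, ∀ q ∈ G, p.1 < q.1 ↔ p.2 < q.2)
    {t y t' y' : ℝ} (h : InterpolatesAt G t y) (h' : InterpolatesAt G t' y') (htt : t < t') :
    y < y' := by
  have hle : ∀ p ∈ G, ∀ q ∈ G, p.1 ≤ q.1 ↔ p.2 ≤ q.2 := fun p hp q hq ↦ by
    simpa only [not_lt] using not_congr (hG q hq p hp)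
  obtain ⟨p, hp, q, hq, h1, h2, h3, h4, h5, h6⟩ := h
  obtain ⟨p', hp', q', hq', h1', h2', h3', h4', h5', h6'⟩ := h'
  by_cases hc : q.1 ≤ p'.1
  · have hc2 := (hle q hq p' hp').1 hc
    refine lt_of_le_of_ne (by linarith) fun hy ↦ ?_
    have e1 : y = q.2 := by linarith
    have e2 : y' = p'.2 := by linarith
    have e3 : p'.1 ≤ q.1 := (hle p' hp' q hq).2 (by linarith)
    have a1 : t = q.1 := by
      rcases (h1.trans h2).eq_or_lt with hpq | hpq
      · linarith
      · have := (hG p hp q hq).1 hpq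
        have h7 : (q.2 - p.2) * (q.1 - t) = 0 := by rw [e1] at h6; linarith
        rcases mul_eq_zero.1 h7 with h8 | h8 <;> linarith
    have a2 : t' = p'.1 := by
      rcases (h1'.trans h2').eq_or_lt with hpq | hpq
      · linarith
      · have := (hG p' hp' q' hq').1 hpq
        have h7 : (q'.2 - p'.2) * (t' - p'.1) = 0 := by rw [e2] at h6'; linarith
        rcases mul_eq_zero.1 h7 with h8 | h8 <;> linarith
    linarith
  · push Not at hc
    have b1 : p'.1 = p.1 := by
      rcases h5 p' hp' with h | h
      · rcases h5' p hp with h' | h' <;> linarith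
      · linarith
    have b2 : q'.1 = q.1 := by
      rcases h5' q hq with h | h
      · linarith
      · rcases h5 q' hq' with h' | h' <;> linarith
    have c1 : p'.2 = p.2 :=
      le_antisymm ((hle p' hp' p hp).1 b1.le) ((hle p hp p' hp').1 b1.ge)
    have c2 : q'.2 = q.2 :=
      le_antisymm ((hle q' hq' q hq).1 b2.le) ((hle q hq q' hq').1 b2.ge)
    have c3 : p.1 < q.1 := by linarith
    have c4 := (hG p hp q hq).1 c3
    rw [b1, b2, c1, c2] at h6'
    have c5 : 0 < (t' - t) * (q.2 - p.2) := mul_pos (by linarith) (by linarith)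
    have c6 : 0 < (y' - y) * (q.1 - p.1) := by linarith
    have := (mul_pos_iff_of_pos_right (sub_pos.2 c3)).1 c6
    linarith

theorem InterpolatesAt.swap {G : Set (ℝ × ℝ)} (hG : ∀ p ∈ G, ∀ q ∈ G, p.1 < q.1 ↔ p.2 < q.2)
    {t y : ℝ} (h : InterpolatesAt G t y) : InterpolatesAt (Prod.swap '' G) y t := by
  obtain ⟨p, hp, q, hq, h1, h2, h3, h4, h5, h6⟩ := h
  refine ⟨_, mem_image_of_mem _ hp, _, mem_image_of_mem _ hq, h3, h4, h1, h2, ?_, h6.symm⟩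
  rintro _ ⟨s, hs, rfl⟩
  have a := not_congr (hG p hp s hs)
  have b := not_congr (hG s hs q hq)
  simp only [not_lt] at a b
  simpa [a, b] using h5 s hs

theorem exists_gap {S : Set ℝ} (hS : IsClosed S) (hb : ¬BddBelow S) (ha : ¬BddAbove S) (t : ℝ) :
    ∃ l ∈ S, ∃ r ∈ S, l ≤ t ∧ t ≤ r ∧ ∀ s ∈ S, s ≤ l ∨ r ≤ s := by
  rw [not_bddBelow_iff] at hb
  rw [not_bddAbove_iff] at ha
  obtain ⟨x, hx, hxt⟩ := hb t
  obtain ⟨y, hy, hyt⟩ := ha t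
  have hl : sSup (S ∩ Iic t) ∈ S ∩ Iic t :=
    (hS.inter isClosed_Iic).csSup_mem ⟨x, hx, hxt.le⟩ ⟨t, fun z hz ↦ hz.2⟩
  have hr : sInf (S ∩ Ici t) ∈ S ∩ Ici t :=
    (hS.inter isClosed_Ici).csInf_mem ⟨y, hy, hyt.le⟩ ⟨t, fun z hz ↦ hz.2⟩
  refine ⟨_, hl.1, _, hr.1, hl.2, hr.2, fun s hs ↦ ?_⟩
  rcases le_total s t with h | h
  · exact .inl (le_csSup ⟨t, fun z hz ↦ hz.2⟩ ⟨hs, h⟩)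
  · exact .inr (csInf_le ⟨t, fun z hz ↦ hz.2⟩ ⟨hs, h⟩)

theorem exists_interpolatesAt {G : Set (ℝ × ℝ)}
    (hG : ∀ p ∈ G, ∀ q ∈ G, p.1 < q.1 ↔ p.2 < q.2) (hc : IsClosed (Prod.fst '' G))
    (hb : ¬BddBelow (Prod.fst '' G)) (ha : ¬BddAbove (Prod.fst '' G)) (t : ℝ) :
    ∃ y, InterpolatesAt G t y := by
  obtain ⟨_, ⟨p, hp, rfl⟩, _, ⟨q, hq, rfl⟩, h1, h2, h3⟩ := exists_gap hc hb ha t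
  have hle : p.2 ≤ q.2 := by
    simpa using mt (hG q hq p hp).2 (by linarith)
  have h3' : ∀ s ∈ G, s.1 ≤ p.1 ∨ q.1 ≤ s.1 := fun s hs ↦ h3 _ (mem_image_of_mem Prod.fst hs)
  rcases (h1.trans h2).eq_or_lt with h | h
  · exact ⟨p.2, p, hp, q, hq, h1, h2, le_rfl, hle, h3',
      by rw [show t = p.1 by linarith]; ring⟩
  · have hd : 0 < q.1 - p.1 := by linarith
    refine ⟨p.2 + (t - p.1) / (q.1 - p.1) * (q.2 - p.2), p, hp, q, hq, h1, h2, ?_, ?_, h3', ?_⟩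
    · have : 0 ≤ (t - p.1) / (q.1 - p.1) * (q.2 - p.2) :=
        mul_nonneg (div_nonneg (by linarith) hd.le) (by linarith)
      linarith
    · have : (t - p.1) / (q.1 - p.1) ≤ 1 := (div_le_one hd).2 (by linarith)
      nlinarith
    · field_simp
      ring

/-- A closed order-preserving correspondence between unbounded subsets of the line extends to a
homeomorphism of the line. -/
theorem exists_homeomorph_extending_graph {G : Set (ℝ × ℝ)}
    (hG : ∀ p ∈ G, ∀ q ∈ G, p.1 < q.1 ↔ p.2 < q.2)
    (hc₁ : IsClosed (Prod.fst '' G)) (hb₁ : ¬BddBelow (Prod.fst '' G))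
    (ha₁ : ¬BddAbove (Prod.fst '' G))
    (hc₂ : IsClosed (Prod.snd '' G)) (hb₂ : ¬BddBelow (Prod.snd '' G))
    (ha₂ : ¬BddAbove (Prod.snd '' G)) :
    ∃ h : ℝ ≃ₜ ℝ, ∀ p ∈ G, h p.1 = p.2 := by
  have hG' : ∀ p ∈ Prod.swap '' G, ∀ q ∈ Prod.swap '' G, p.1 < q.1 ↔ p.2 < q.2 := by
    rintro _ ⟨p, hp, rfl⟩ _ ⟨q, hq, rfl⟩
    exact (hG p hp q hq).symm
  have hfs : Prod.fst '' (Prod.swap '' G) = Prod.snd '' G := by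
    simp [image_image]
  have hss : Prod.swap '' (Prod.swap '' G) = G := by
    simp [image_image]
  choose f hf using exists_interpolatesAt hG hc₁ hb₁ ha₁
  have hmono : StrictMono f := fun t t' htt ↦ (hf t).lt hG (hf t') htt
  have huniq : ∀ t y, InterpolatesAt G t y → f t = y := by
    intro t y hy
    rcases lt_trichotomy (f t) y with h | h | h
    · exact absurd (((hf t).swap hG).lt hG' (hy.swap hG) h) (lt_irrefl _)
    · exact h
    · exact absurd ((hy.swap hG).lt hG' ((hf t).swap hG) h) (lt_irrefl _)
  have hsurj : Function.Surjective f := fun y ↦ by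
    obtain ⟨t, ht⟩ := exists_interpolatesAt hG' (by rwa [hfs]) (by rwa [hfs]) (by rwa [hfs]) y
    have := ht.swap hG'
    rw [hss] at this
    exact ⟨t, huniq t y this⟩
  refine ⟨(hmono.orderIsoOfSurjective f hsurj).toHomeomorph, fun p hp ↦ huniq _ _ ?_⟩
  refine ⟨p, hp, p, hp, le_rfl, le_rfl, le_rfl, le_rfl, fun s _ ↦ le_total _ _, by ring⟩

/-- Two order-isomorphic compact subsets of the line are ambiently homeomorphic. -/
theorem exists_homeomorph_comp_eq {ι : Type*} [TopologicalSpace ι] [CompactSpace ι] [Nonempty ι]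
    {φ e : ι → ℝ} (hφ : Continuous φ) (he : Continuous e)
    (h : ∀ x y, φ x < φ y ↔ e x < e y) : ∃ g : ℝ ≃ₜ ℝ, ∀ x, g (φ x) = e x := by
  obtain ⟨m, -, hm⟩ := isCompact_univ.exists_isMinOn univ_nonempty hφ.continuousOn
  obtain ⟨M, -, hM⟩ := isCompact_univ.exists_isMaxOn univ_nonempty hφ.continuousOn
  have hle : ∀ x y, φ x ≤ φ y ↔ e x ≤ e y := fun x y ↦ by
    simpa only [not_lt] using not_congr (h y x)
  have hm' : ∀ x, φ m ≤ φ x := fun x ↦ hm (mem_univ x)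
  have hM' : ∀ x, φ x ≤ φ M := fun x ↦ hM (mem_univ x)
  have hme : ∀ x, e m ≤ e x := fun x ↦ (hle _ _).1 (hm' x)
  have hMe : ∀ x, e x ≤ e M := fun x ↦ (hle _ _).1 (hM' x)
  let G : Set (ℝ × ℝ) := range (fun x ↦ (φ x, e x)) ∪ (fun s ↦ (φ m - s, e m - s)) '' Ici 0 ∪
    (fun s ↦ (φ M + s, e M + s)) '' Ici 0
  have hG : ∀ p ∈ G, ∀ q ∈ G, p.1 < q.1 ↔ p.2 < q.2 := by
    have hmM := hm' M
    have hmMe := hme M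
    rintro _ ((⟨x, rfl⟩ | ⟨s, hs, rfl⟩) | ⟨s, hs, rfl⟩) _
      ((⟨y, rfl⟩ | ⟨t, ht, rfl⟩) | ⟨t, ht, rfl⟩) <;> simp only [mem_Ici] at *
    · exact h x y
    · exact iff_of_false (by linarith [hm' x]) (by linarith [hme x])
    · rcases ht.eq_or_lt with rfl | ht
      · simpa using h x M
      · exact iff_of_true (by linarith [hM' x]) (by linarith [hMe x])
    · rcases hs.eq_or_lt with rfl | hs
      · simpa using h m y
      · exact iff_of_true (by linarith [hm' y]) (by linarith [hme y])
    · constructor <;> intro <;> linarith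
    · rcases hs.eq_or_lt with rfl | hs
      · rcases ht.eq_or_lt with rfl | ht
        · simpa using h m M
        · exact iff_of_true (by linarith) (by linarith)
      · exact iff_of_true (by linarith) (by linarith)
    · exact iff_of_false (by linarith [hM' y]) (by linarith [hMe y])
    · exact iff_of_false (by linarith) (by linarith)
    · constructor <;> intro <;> linarith
  have hsub : ∀ a : ℝ, (fun s ↦ a - s) '' Ici 0 = Iic a := fun a ↦ by simp
  have hadd : ∀ a : ℝ, (fun s ↦ a + s) '' Ici 0 = Ici a := fun a ↦ by simp
  have h1 : Prod.fst '' G = range φ ∪ Iic (φ m) ∪ Ici (φ M) := by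
    simp only [G, image_union, ← range_comp, image_image, hsub, hadd]; rfl
  have h2 : Prod.snd '' G = range e ∪ Iic (e m) ∪ Ici (e M) := by
    simp only [G, image_union, ← range_comp, image_image, hsub, hadd]; rfl
  have hbb : ∀ (S : Set ℝ) (a b : ℝ), ¬BddBelow (S ∪ Iic a ∪ Ici b) := fun S a b hb ↦
    not_bddBelow_Iic a (hb.mono (by grind))
  have hba : ∀ (S : Set ℝ) (a b : ℝ), ¬BddAbove (S ∪ Iic a ∪ Ici b) := fun S a b hb ↦
    not_bddAbove_Ici b (hb.mono (by grind))
  have hcl : ∀ {f : ι → ℝ}, Continuous f → ∀ a b : ℝ, IsClosed (range f ∪ Iic a ∪ Ici b) :=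
    fun hf a b ↦ ((isCompact_range hf).isClosed.union isClosed_Iic).union isClosed_Ici
  obtain ⟨g, hg⟩ := exists_homeomorph_extending_graph (G := G) hG
    (h1 ▸ hcl hφ _ _) (h1 ▸ hbb _ _ _) (h1 ▸ hba _ _ _)
    (h2 ▸ hcl he _ _) (h2 ▸ hbb _ _ _) (h2 ▸ hba _ _ _)
  exact ⟨g, fun x ↦ hg (φ x, e x) (.inl (.inl ⟨x, rfl⟩))⟩

theorem continuous_apply_natRec {α β : Type*} [TopologicalSpace β] (a : α) (step : Bool → α → α)
    (g : α → β) (n : ℕ) :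
    Continuous fun w : ℕ → Bool ↦ g (Nat.rec a (fun k r ↦ step (w k) r) n) := by
  let _ : TopologicalSpace α := ⊥
  have _ : DiscreteTopology α := ⟨rfl⟩
  refine continuous_of_discreteTopology.comp ?_
  induction n with
  | zero => exact continuous_const
  | succ n ih =>
    exact (continuous_of_discreteTopology (f := fun p : Bool × α ↦ step p.1 p.2)).comp
      ((continuous_apply n).prodMk ih)

theorem exists_separated_cylinders {d : (ℕ → Bool) → ℝ} (hd : Continuous d)
    (hinj : Function.Injective d) (x : ℕ → Bool) (n : ℕ) :
    ∃ y z : ℕ → Bool, ∃ m > n, y ∈ PiNat.cylinder x n ∧ z ∈ PiNat.cylinder x n ∧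
      ∀ y' ∈ PiNat.cylinder y m, ∀ z' ∈ PiNat.cylinder z m, d y' < d z' := by
  have key : ∀ y z : ℕ → Bool, d y < d z → ∃ m > n,
      ∀ y' ∈ PiNat.cylinder y m, ∀ z' ∈ PiNat.cylinder z m, d y' < d z' := by
    intro y z hyz
    obtain ⟨c, hc₁, hc₂⟩ := exists_between hyz
    have hnhds : ∀ (w : ℕ → Bool) (U : Set (ℕ → Bool)), IsOpen U → w ∈ U →
        ∃ m, PiNat.cylinder w m ⊆ U := fun w U hU hw ↦ by
      obtain ⟨_, ⟨v, m, rfl⟩, hwv, hvU⟩ :=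
        (PiNat.isTopologicalBasis_cylinders fun _ : ℕ ↦ Bool).exists_subset_of_mem_open hw hU
      exact ⟨m, PiNat.mem_cylinder_iff_eq.1 hwv ▸ hvU⟩
    obtain ⟨m₁, h₁⟩ := hnhds y (d ⁻¹' Iio c) (isOpen_Iio.preimage hd) hc₁
    obtain ⟨m₂, h₂⟩ := hnhds z (d ⁻¹' Ioi c) (isOpen_Ioi.preimage hd) hc₂
    refine ⟨max (n + 1) (max m₁ m₂), by lia, fun y' hy' z' hz' ↦ ?_⟩
    exact lt_trans (h₁ (PiNat.cylinder_anti _ (by lia) hy'))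
      (h₂ (PiNat.cylinder_anti _ (by lia) hz'))
  let x' := Function.update x n (!x n)
  have hx' : x' ∈ PiNat.cylinder x n := PiNat.update_mem_cylinder x n _
  have hne : d x ≠ d x' := fun h ↦ by
    have := congrFun (hinj h) n
    simp [x'] at this
  rcases lt_or_gt_of_ne hne with h | h
  · obtain ⟨m, hm, hsep⟩ := key _ _ h
    exact ⟨x, x', m, hm, PiNat.self_mem_cylinder x n, hx', hsep⟩
  · obtain ⟨m, hm, hsep⟩ := key _ _ h
    exact ⟨x', x, m, hm, hx', PiNat.self_mem_cylinder x n, hsep⟩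

/-- A continuous injective real function on the Cantor space is strictly increasing for the
lexicographic order along some continuous self-map of the Cantor space. -/
theorem exists_continuous_lex_strictMono {d : (ℕ → Bool) → ℝ} (hd : Continuous d)
    (hinj : Function.Injective d) :
    ∃ θ : (ℕ → Bool) → ℕ → Bool, Continuous θ ∧ ∀ x y n, (∀ i < n, x i = y i) →
      x n = false → y n = true → d (θ x) < d (θ y) := by
  choose! l r m hm hl hr hsep using exists_separated_cylinders hd hinj
  let step : Bool → (ℕ → Bool) × ℕ → (ℕ → Bool) × ℕ :=
    fun b p ↦ (cond b (r p.1 p.2) (l p.1 p.2), m p.1 p.2)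
  let node : (ℕ → Bool) → ℕ → (ℕ → Bool) × ℕ :=
    fun w n ↦ Nat.rec (fun _ ↦ false, 0) (fun k p ↦ step (w k) p) n
  have hnode : ∀ w n, node w (n + 1) = step (w n) (node w n) := fun _ _ ↦ rfl
  have hlen : ∀ w n, n ≤ (node w n).2 := fun w n ↦ by
    induction n with
    | zero => simp
    | succ n ih => rw [hnode]; exact ih.trans_lt (hm _ _)
  have hsucc : ∀ w n, (node w (n + 1)).1 ∈ PiNat.cylinder (node w n).1 (node w n).2 ∧
      (node w n).2 ≤ (node w (n + 1)).2 := fun w n ↦ by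
    rw [hnode]
    refine ⟨?_, (hm _ _).le⟩
    cases w n
    · exact hl _ _
    · exact hr _ _
  have hle : ∀ w n k, n ≤ k → (node w k).1 ∈ PiNat.cylinder (node w n).1 (node w n).2 ∧
      (node w n).2 ≤ (node w k).2 := fun w n k hnk ↦ by
    induction k, hnk using Nat.le_induction with
    | base => exact ⟨PiNat.self_mem_cylinder _ _, le_rfl⟩
    | succ k _ ih =>
      refine ⟨fun i hi ↦ ?_, ih.2.trans (hsucc w k).2⟩
      rw [(hsucc w k).1 i (by lia), ih.1 i hi]
  let θ : (ℕ → Bool) → ℕ → Bool := fun w i ↦ (node w (i + 1)).1 i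
  have hθ : ∀ w n, θ w ∈ PiNat.cylinder (node w n).1 (node w n).2 := fun w n i hi ↦ by
    rcases le_total n (i + 1) with h | h
    · exact (hle w n _ h).1 i hi
    · exact ((hle w (i + 1) n h).1 i (hlen w (i + 1))).symm
  refine ⟨θ, continuous_pi fun i ↦
    continuous_apply_natRec _ step (fun p ↦ p.1 i) (i + 1), fun x y n hxy hx hy ↦ ?_⟩
  have heq : ∀ k ≤ n, node x k = node y k := fun k hk ↦ by
    induction k with
    | zero => rfl
    | succ k ih => rw [hnode, hnode, ih (by lia), hxy k (by lia)]
  have h1 := hθ x (n + 1)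
  have h2 := hθ y (n + 1)
  rw [hnode, hx, heq n le_rfl] at h1
  rw [hnode, hy] at h2
  exact hsep _ _ _ h1 _ h2

/-- The standard parametrization of the middle-thirds Cantor set by binary sequences. -/
def cantorParam (w : ℕ → Bool) : ℝ := cantorSetHomeomorphNatToBool.symm w

theorem continuous_cantorParam : Continuous cantorParam :=
  continuous_subtype_val.comp cantorSetHomeomorphNatToBool.symm.continuous

theorem range_cantorParam : range cantorParam = cantorSet := by
  have : cantorParam = Subtype.val ∘ cantorSetHomeomorphNatToBool.symm := rfl
  rw [this, range_comp, cantorSetHomeomorphNatToBool.symm.surjective.range_eq, image_univ,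
    Subtype.range_coe]

theorem cantorParam_eq (w : ℕ → Bool) :
    cantorParam w = Real.ofDigits fun i ↦ cond (w i) (2 : Fin 3) 0 := rfl

theorem cantorParam_lt {x y : ℕ → Bool} {n : ℕ} (hxy : ∀ i < n, x i = y i)
    (hx : x n = false) (hy : y n = true) : cantorParam x < cantorParam y := by
  rw [cantorParam_eq, cantorParam_eq, Real.ofDigits_eq_sum_add_ofDigits _ (n + 1),
    Real.ofDigits_eq_sum_add_ofDigits (fun i ↦ cond (y i) (2 : Fin 3) 0) (n + 1),
    Finset.sum_range_succ, Finset.sum_range_succ]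
  have hsum : ∑ i ∈ Finset.range n, Real.ofDigitsTerm (fun i ↦ cond (x i) (2 : Fin 3) 0) i =
      ∑ i ∈ Finset.range n, Real.ofDigitsTerm (fun i ↦ cond (y i) (2 : Fin 3) 0) i :=
    Finset.sum_congr rfl fun i hi ↦ by
      simp [Real.ofDigitsTerm, hxy i (Finset.mem_range.1 hi)]
  have h1 := Real.ofDigits_le_one fun i ↦ cond (x (i + (n + 1))) (2 : Fin 3) 0
  have h2 := Real.ofDigits_nonneg fun i ↦ cond (y (i + (n + 1))) (2 : Fin 3) 0
  have h3 : (0 : ℝ) < ((3 : ℕ) ^ (n + 1) : ℝ)⁻¹ := by positivity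
  rw [hsum]
  simp only [Real.ofDigitsTerm, hx, hy, cond_true, cond_false]
  have h4 : (((2 : Fin 3) : ℕ) : ℝ) = 2 := by norm_num
  have h5 : (((0 : Fin 3) : ℕ) : ℝ) = 0 := by norm_num
  rw [h4, h5]
  nlinarith

/-- Along some continuous self-map of the Cantor space, a continuous injective real function on
the Cantor space becomes ambiently equivalent to the parametrization of the Cantor set. -/
theorem exists_homeomorph_cantorParam {d : (ℕ → Bool) → ℝ} (hd : Continuous d)
    (hinj : Function.Injective d) :
    ∃ θ : (ℕ → Bool) → ℕ → Bool, Continuous θ ∧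
      ∃ h : ℝ ≃ₜ ℝ, ∀ w, h (d (θ w)) = cantorParam w := by
  obtain ⟨θ, hθ, hlt⟩ := exists_continuous_lex_strictMono hd hinj
  refine ⟨θ, hθ, exists_homeomorph_comp_eq (hd.comp hθ) continuous_cantorParam fun x y ↦ ?_⟩
  by_cases hxy : x = y
  · simp [hxy]
  have hex : ∃ n, x n ≠ y n := Function.ne_iff.1 hxy
  have hmin : ∀ i < Nat.find hex, x i = y i := fun i hi ↦ by simpa using Nat.find_min hex hi
  have hne := Nat.find_spec hex
  generalize Nat.find hex = n at hmin hne
  cases hx : x n <;> cases hy : y n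
  · simp [hx, hy] at hne
  · exact iff_of_true (hlt x y n hmin hx hy) (cantorParam_lt hmin hx hy)
  · have hmin' : ∀ i < n, y i = x i := fun i hi ↦ (hmin i hi).symm
    exact iff_of_false (hlt y x n hmin' hy hx).not_gt (cantorParam_lt hmin' hy hx).not_gt
  · simp [hx, hy] at hne

/-- A compact set has a point that is lexicographically minimal for finitely many continuous
functions. -/
theorem IsCompact.exists_lexMin {E : Type*} [TopologicalSpace E] [T2Space E] {K : Set E}
    (hK : IsCompact K) (hne : K.Nonempty) {u : ℕ → E → ℝ} (hu : ∀ i, Continuous (u i)) (m : ℕ) :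
    ∃ x ∈ K, ∀ x' ∈ K, ∀ j < m, (∀ i < j, u i x' = u i x) → u j x ≤ u j x' := by
  induction m with
  | zero => exact hne.imp fun x hx ↦ ⟨hx, by simp⟩
  | succ m ih =>
    obtain ⟨x, hx, hmin⟩ := ih
    have hcl : IsClosed {x' | ∀ i < m, u i x' = u i x} := by
      simp only [ofPred_forall]
      exact isClosed_iInter fun i ↦ isClosed_iInter fun _ ↦ isClosed_eq (hu i) continuous_const
    obtain ⟨z, ⟨hzK, hzx⟩, hz⟩ := (hK.inter_right hcl).exists_isMinOn ⟨x, hx, fun _ _ ↦ rfl⟩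
      (hu m).continuousOn
    simp only [mem_ofPred_eq] at hzx
    refine ⟨z, hzK, fun x' hx' j hj heq ↦ ?_⟩
    rcases (Nat.lt_succ_iff.1 hj).eq_or_lt with rfl | hj
    · exact hz ⟨hx', fun i hi ↦ (heq i hi).trans (hzx i hi)⟩
    · rw [hzx j hj]
      exact hmin x' hx' j hj fun i hi ↦ (heq i hi).trans (hzx i (hi.trans hj))

theorem measurableSet_lexMin {E : Type*} [TopologicalSpace E] [T2Space E] [MeasurableSpace E]
    [BorelSpace E] {X : Set E} (hX : IsCompact X) {π : E → ℝ} (hπ : Continuous π)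
    {u : ℕ → E → ℝ} (hu : ∀ i, Continuous (u i)) (m : ℕ) :
    MeasurableSet {x ∈ X | ∀ x' ∈ X, π x' = π x → ∀ j < m, (∀ i < j, u i x' = u i x) →
      u j x ≤ u j x'} := by
  let D : ℕ → ℕ → Set (E × E) := fun j k ↦ {p | π p.2 = π p.1} ∩ {p | ∀ i < j, u i p.2 = u i p.1} ∩
    {p | u j p.2 + 1 / ((k : ℝ) + 1) ≤ u j p.1}
  have hD : ∀ j k, IsClosed (D j k) := fun j k ↦ by
    refine ((isClosed_eq (by fun_prop) (by fun_prop)).inter ?_).inter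
      (isClosed_le (by fun_prop) (by fun_prop))
    simp only [ofPred_forall]
    exact isClosed_iInter fun i ↦ isClosed_iInter fun _ ↦
      isClosed_eq (by fun_prop) (by fun_prop)
  have heq : {x ∈ X | ∀ x' ∈ X, π x' = π x → ∀ j < m, (∀ i < j, u i x' = u i x) →
      u j x ≤ u j x'} = X \ ⋃ j, ⋃ _ : j < m, ⋃ k, Prod.fst '' (X ×ˢ X ∩ D j k) := by
    ext x
    refine and_congr_right fun hx ↦ ?_
    simp only [mem_iUnion, not_exists]
    constructor
    · rintro h j hj k ⟨⟨_, x'⟩, ⟨⟨-, hx'⟩, ⟨h1, h2⟩, h3⟩, rfl⟩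
      have h4 := h x' hx' h1 j hj h2
      have h5 : (0 : ℝ) < 1 / ((k : ℝ) + 1) := by positivity
      simp only [mem_ofPred_eq] at h3
      linarith
    · intro h x' hx' h1 j hj h2
      by_contra! h3
      obtain ⟨k, hk⟩ := exists_nat_one_div_lt (sub_pos.2 h3)
      exact h j hj k ⟨(x, x'), ⟨⟨hx, hx'⟩, ⟨h1, h2⟩, by simp only [mem_ofPred_eq]; linarith⟩, rfl⟩
  rw [heq]
  refine hX.isClosed.measurableSet.diff (.iUnion fun j ↦ .iUnion fun _ ↦ .iUnion fun k ↦ ?_)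
  exact (((hX.prod hX).inter_right (hD j k)).image continuous_fst).isClosed.measurableSet

theorem MeasurableSet.exists_nat_bool_injection_of_not_countable {E : Type*} [t : TopologicalSpace E]
    [PolishSpace E] [MeasurableSpace E] [BorelSpace E] {S : Set E} (hS : MeasurableSet S)
    (hunc : ¬S.Countable) :
    ∃ f : (ℕ → Bool) → E, range f ⊆ S ∧ Continuous f ∧ Function.Injective f := by
  obtain ⟨t', hle, hpol, hcl, -⟩ := hS.isClopenable
  obtain ⟨f, hf, hcont, hinj⟩ :=
    @IsClosed.exists_nat_bool_injection_of_not_countable E t' hpol S hcl hunc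
  exact ⟨f, hf, continuous_le_rng hle hcont, hinj⟩

/-- If a compact set `X` has uncountable image under `π`, then it contains a Cantor set on which
`π` is injective and whose points minimize a given function on the fibres of `π` in `X`. -/
theorem IsCompact.exists_cantor_section {E : Type*} [TopologicalSpace E] [PolishSpace E] {X : Set E}
    (hX : IsCompact X) {π : E → ℝ} (hπ : Continuous π) (hunc : ¬(π '' X).Countable)
    {u : ℕ → E → ℝ} (hu : ∀ i, Continuous (u i)) {m : ℕ} (hm : 0 < m)
    (hsep : ∀ x y, (∀ i < m, u i x = u i y) → x = y) :
    ∃ c : (ℕ → Bool) → E, Continuous c ∧ (∀ w, c w ∈ X) ∧ Function.Injective (π ∘ c) ∧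
      ∀ w, ∀ x ∈ X, π x = π (c w) → u 0 (c w) ≤ u 0 x := by
  borelize E
  let S := {x ∈ X | ∀ x' ∈ X, π x' = π x → ∀ j < m, (∀ i < j, u i x' = u i x) → u j x ≤ u j x'}
  have hπS : π '' X ⊆ π '' S := by
    rintro _ ⟨x₀, hx₀, rfl⟩
    obtain ⟨x, ⟨hx, hxπ⟩, hmin⟩ := (hX.inter_right (isClosed_eq hπ continuous_const)).exists_lexMin
      (K := X ∩ {x | π x = π x₀}) ⟨x₀, hx₀, rfl⟩ hu m
    simp only [mem_ofPred_eq] at hxπ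
    exact ⟨x, ⟨hx, fun x' hx' hx'π ↦ hmin x' ⟨hx', hx'π.trans hxπ⟩⟩, hxπ⟩
  obtain ⟨c, hcS, hc, hinj⟩ :=
    (measurableSet_lexMin hX hπ hu m).exists_nat_bool_injection_of_not_countable (S := S)
      fun h ↦ hunc ((h.image π).mono hπS)
  have hcS' : ∀ w, c w ∈ S := fun w ↦ hcS (mem_range_self w)
  refine ⟨c, hc, fun w ↦ (hcS' w).1, fun w w' hww ↦ hinj (hsep _ _ fun i hi ↦ ?_),
    fun w x hx hxw ↦ (hcS' w).2 x hx hxw 0 hm (by simp)⟩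
  induction i using Nat.strong_induction_on with
  | _ i ih =>
    exact le_antisymm
      ((hcS' w).2 _ (hcS' w').1 hww.symm i hi fun k hk ↦ (ih k hk (hk.trans hi)).symm)
      ((hcS' w').2 _ (hcS' w).1 hww i hi fun k hk ↦ ih k hk (hk.trans hi))

theorem exists_continuous_modulus {E : Type*} [TopologicalSpace E] {X : Set E} (hX : IsCompact X)
    {d v : E → ℝ} (hd : Continuous d) (hv : Continuous v) (hd₀ : ∀ x, 0 ≤ d x)
    (h : ∀ x ∈ X, d x = 0 → v x ≤ 0) :
    ∃ ω : ℝ → ℝ, Continuous ω ∧ ω 0 = 0 ∧ ∀ x ∈ X, v x ≤ ω (d x) := by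
  have : CompactSpace X := isCompact_iff_compactSpace.1 hX
  let f : ℝ → X → ℝ := fun r x ↦ 2 * max (v x) 0 * (|r| / (|r| + d x))
  have hratio : ∀ (r : ℝ) (x : X), 0 ≤ |r| / (|r| + d x) ∧ |r| / (|r| + d x) ≤ 1 := fun r x ↦
    ⟨div_nonneg (abs_nonneg r) (add_nonneg (abs_nonneg r) (hd₀ x)),
      div_le_one_of_le₀ (by linarith [hd₀ x]) (add_nonneg (abs_nonneg r) (hd₀ x))⟩
  have hf : Continuous ↿f := by
    rw [continuous_iff_continuousAt]
    rintro ⟨r, x⟩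
    by_cases h0 : |r| + d x = 0
    · have hr : |r| = 0 := by linarith [hd₀ x, abs_nonneg r]
      have hx : v x ≤ 0 := h x x.2 (by linarith)
      have hlim : ContinuousAt (fun p : ℝ × X ↦ 2 * max (v p.2) 0) (r, x) := by fun_prop
      have h00 : ↿f (r, x) = 0 := by simp [f, Function.HasUncurry.uncurry, hr]
      rw [ContinuousAt, h00]
      rw [ContinuousAt, max_eq_right hx, mul_zero] at hlim
      refine squeeze_zero (fun p ↦ ?_) (fun p ↦ ?_) hlim
      · exact mul_nonneg (by positivity) (hratio p.1 p.2).1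
      · exact mul_le_of_le_one_right (by positivity) (hratio p.1 p.2).2
    · have : ContinuousAt (fun p : ℝ × X ↦ |p.1| / (|p.1| + d p.2)) (r, x) :=
        ContinuousAt.div (by fun_prop) (by fun_prop) h0
      exact ContinuousAt.mul (f := fun p : ℝ × X ↦ 2 * max (v p.2) 0) (by fun_prop) this
  refine ⟨fun r ↦ sSup (f r '' univ), isCompact_univ.continuous_sSup hf, ?_, fun x hx ↦ ?_⟩
  · rcases (univ : Set X).eq_empty_or_nonempty with he | hne
    · simp [he]
    · have : f 0 = fun _ ↦ 0 := by funext x; simp [f]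
      change sSup (f 0 '' univ) = 0
      rw [this, hne.image_const, csSup_singleton]
  · have hbdd : BddAbove (f (d x) '' univ) :=
      (isCompact_univ.image (hf.comp (Continuous.prodMk_right (d x)))).bddAbove
    refine le_trans ?_ (le_csSup hbdd ⟨⟨x, hx⟩, mem_univ _, rfl⟩)
    rcases (hd₀ x).eq_or_lt with h0 | h0
    · simpa [f, ← h0] using h x hx h0.symm
    · have h1 : d x / (d x + d x) = 1 / 2 := by field_simp; norm_num
      simp only [f, abs_of_pos h0, h1]
      linarith [le_max_left (v x) 0]

/-- The homeomorphism that moves the coordinate `b` by `h` and then shears every other coordinate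
by a function of the new coordinate `b`. -/
@[simps]
def fiberShear {ι : Type*} [DecidableEq ι] (b : ι) (h : ℝ ≃ₜ ℝ) (G : ι → C(ℝ, ℝ)) :
    (ι → ℝ) ≃ₜ (ι → ℝ) where
  toFun x i := if i = b then h (x b) else x i - G i (h (x b))
  invFun y i := if i = b then h.symm (y b) else y i + G i (y b)
  left_inv x := by
    funext i
    by_cases hi : i = b <;> simp [hi]
  right_inv y := by
    funext i
    by_cases hi : i = b <;> simp [hi]
  continuous_toFun := continuous_pi fun i ↦ by
    by_cases hi : i = b <;> simp only [hi, if_true, if_false] <;> fun_prop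
  continuous_invFun := continuous_pi fun i ↦ by
    by_cases hi : i = b <;> simp only [hi, if_true, if_false] <;> fun_prop

/-- The shear of the coordinate `a` by a function of the other coordinates. -/
@[simps]
def coordShear {ι : Type*} [DecidableEq ι] (a : ι) (q : C(ι → ℝ, ℝ))
    (hq : ∀ x r, q (Function.update x a r) = q x) : (ι → ℝ) ≃ₜ (ι → ℝ) where
  toFun x := Function.update x a (x a + q x)
  invFun y := Function.update y a (y a - q y)
  left_inv x := by simp [hq]
  right_inv y := by simp [hq]
  continuous_toFun := by fun_prop
  continuous_invFun := by fun_prop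

/-- A homeomorphism fixing the coordinate axis `b` pointwise and squeezing a cone around its unit
segment into a cube. -/
@[simps]
def coneSqueeze {ι : Type*} [DecidableEq ι] (a b : ι) (hab : a ≠ b) (c : ℝ) (hc : c ≠ 0) :
    (ι → ℝ) ≃ₜ (ι → ℝ) where
  toFun x i := if i = b then (x b + 2 * |x a|) / (1 + 4 * |x a|) else
    if i = a then c * x a else c * (x i + 2 * x a)
  invFun y i := if i = b then y b * (1 + 4 * |y a / c|) - 2 * |y a / c| else
    if i = a then y a / c else y i / c - 2 * (y a / c)
  left_inv x := by
    have h4 : 1 + 4 * |x a| ≠ 0 := by positivity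
    funext i
    by_cases hi : i = b
    · simp [hi, hab, hc, h4]
    · by_cases hi' : i = a <;> simp [hi, hi', hab, hc]
  right_inv y := by
    have h4 : 1 + 4 * |y a / c| ≠ 0 := by positivity
    funext i
    by_cases hi : i = b
    · simp [hi, hab, h4]
    · by_cases hi' : i = a
      · simp [hi', hab]; field_simp
      · simp [hi, hi', hab]; field_simp
  continuous_toFun := continuous_pi fun i ↦ by
    by_cases hi : i = b
    · simp only [hi, if_true]
      exact Continuous.div (by fun_prop) (by fun_prop) fun x ↦ by positivity
    · by_cases hi' : i = a <;> simp only [hi, hi', hab, if_true, if_false] <;> fun_prop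
  continuous_invFun := continuous_pi fun i ↦ by
    by_cases hi : i = b
    · simp only [hi, if_true]
      fun_prop
    · by_cases hi' : i = a <;> simp only [hi, hi', hab, if_true, if_false] <;> fun_prop

theorem coneSqueeze_single {ι : Type*} [DecidableEq ι] (a b : ι) (hab : a ≠ b) (c : ℝ)
    (hc : c ≠ 0) (s : ℝ) : coneSqueeze a b hab c hc (Pi.single b s) = Pi.single b s := by
  funext i
  by_cases hi : i = b
  · subst hi; simp [hab]
  · simp [hi, hab]

/-- After an ambient homeomorphism, `X` lies in the half-space `0 ≤ x a` over the Cantor set in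
the coordinate `b`, and contains the Cantor set of the axis `b`. -/
theorem exists_homeomorph_above_cantorSet {n : ℕ} {X : Set (Fin n → ℝ)} (hX : IsCompact X)
    {a b : Fin n} (hab : a ≠ b) (hunc : ¬((fun x ↦ x b) '' X).Countable) :
    ∃ F : (Fin n → ℝ) ≃ₜ (Fin n → ℝ), (∀ x ∈ X, F x b ∈ cantorSet → 0 ≤ F x a) ∧
      ∀ s ∈ cantorSet, Pi.single b s ∈ F '' X := by
  let u : ℕ → (Fin n → ℝ) → ℝ
    | 0, x => x a
    | j + 1, x => if h : j < n then x ⟨j, h⟩ else 0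
  have hu : ∀ j, Continuous (u j)
    | 0 => continuous_apply a
    | j + 1 => by by_cases h : j < n <;> simp only [u, h, dite_true, dite_false] <;> fun_prop
  obtain ⟨c, hc, hcX, hinj, hmin⟩ := hX.exists_cantor_section (continuous_apply b) hunc hu
    n.succ_pos fun x y hxy ↦ funext fun i ↦ by simpa [u] using hxy (i + 1) (by simp)
  obtain ⟨θ, hθ, h, hh⟩ := exists_homeomorph_cantorParam ((continuous_apply b).comp hc) hinj
  simp only [Function.comp_apply] at hh
  have hext : ∀ i, ∃ g : C(ℝ, ℝ), ∀ w, g (cantorParam w) = c (θ w) i := fun i ↦ by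
    obtain ⟨g, hg⟩ := ContinuousMap.exists_restrict_eq isClosed_cantorSet
      (⟨fun s ↦ c (θ (cantorSetHomeomorphNatToBool s)) i, by fun_prop⟩ : C(cantorSet, ℝ))
    exact ⟨g, fun w ↦ by
      simpa [cantorParam] using DFunLike.congr_fun hg (cantorSetHomeomorphNatToBool.symm w)⟩
  choose G hG using hext
  rw [← range_cantorParam]
  refine ⟨fiberShear b h G, fun x hx ↦ ?_, ?_⟩
  · rintro ⟨w, hw⟩
    simp only [fiberShear_apply, if_true, hab, if_false] at hw ⊢
    rw [← hw, hG]
    have hxb : x b = c (θ w) b := h.injective (by rw [← hw, hh])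
    exact sub_nonneg.2 (hmin (θ w) x hx hxb)
  · rintro _ ⟨w, rfl⟩
    refine ⟨c (θ w), hcX _, funext fun i ↦ ?_⟩
    by_cases hi : i = b
    · subst hi; simp [hh]
    · simp [hi, hh, hG]

theorem exists_homeomorph_cone {n : ℕ} {X : Set (Fin n → ℝ)} (hX : IsCompact X)
    {a b : Fin n} (hab : a ≠ b) (hunc : ¬((fun x ↦ x b) '' X).Countable) :
    ∃ F : (Fin n → ℝ) ≃ₜ (Fin n → ℝ),
      (∀ x ∈ X, infDist (F x b) cantorSet ≤ F x a ∧ ∀ i, i ≠ b → |F x i| ≤ F x a) ∧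
      ∀ s ∈ cantorSet, Pi.single b s ∈ F '' X := by
  obtain ⟨F, hF, hFs⟩ := exists_homeomorph_above_cantorSet hX hab hunc
  have hd : Continuous fun t ↦ infDist t cantorSet := continuous_infDist_pt _
  have hmem : ∀ t, t ∈ cantorSet ↔ infDist t cantorSet = 0 := fun t ↦
    isClosed_cantorSet.mem_iff_infDist_zero ⟨0, zero_mem_cantorSet⟩
  obtain ⟨ω, hω, hω₀, hωX⟩ := exists_continuous_modulus hX
    (d := fun x ↦ infDist (F x b) cantorSet) (v := fun x ↦ - F x a)
    (hd.comp (by fun_prop)) (by fun_prop) (fun _ ↦ infDist_nonneg)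
    fun x hx h0 ↦ neg_nonpos.2 (hF x hx ((hmem _).2 h0))
  let q : C(Fin n → ℝ, ℝ) :=
    ⟨fun y ↦ ω (infDist (y b) cantorSet) + infDist (y b) cantorSet +
      ∑ i ∈ Finset.univ \ {a, b}, |y i|, by
      have := hd.comp (continuous_apply (A := fun _ : Fin n ↦ ℝ) b)
      exact ((hω.comp this).add this).add (by fun_prop)⟩
  have hq : ∀ x r, q (Function.update x a r) = q x := fun x r ↦ by
    simp only [q, ContinuousMap.coe_mk, Function.update_of_ne hab.symm]
    congr 1
    refine Finset.sum_congr rfl fun i hi ↦ ?_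
    rw [Function.update_of_ne (by grind)]
  refine ⟨F.trans (coordShear a q hq), fun x hx ↦ ?_, fun s hs ↦ ?_⟩
  · have h1 := hωX x hx
    have h2 : ∀ i ∈ Finset.univ \ {a, b}, |F x i| ≤ ∑ i ∈ Finset.univ \ {a, b}, |F x i| :=
      fun i hi ↦ Finset.single_le_sum (f := fun i ↦ |F x i|) (fun _ _ ↦ abs_nonneg _) hi
    have h3 : 0 ≤ ∑ i ∈ Finset.univ \ {a, b}, |F x i| :=
      Finset.sum_nonneg fun _ _ ↦ abs_nonneg _
    have h4 : 0 ≤ infDist (F x b) cantorSet := infDist_nonneg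
    have h5 : q (F x) = ω (infDist (F x b) cantorSet) + infDist (F x b) cantorSet +
      ∑ i ∈ Finset.univ \ {a, b}, |F x i| := rfl
    simp only [Homeomorph.trans_apply, coordShear_apply, Function.update_self,
      Function.update_of_ne hab.symm]
    refine ⟨by linarith, fun i hi ↦ ?_⟩
    by_cases hia : i = a
    · subst hia
      rw [Function.update_self, abs_of_nonneg (by linarith)]
    · rw [Function.update_of_ne hia]
      linarith [h2 i (by simp [hia, hi])]
  · obtain ⟨x, hx, hxs⟩ := hFs s hs
    refine ⟨x, hx, ?_⟩
    have hq0 : q (Pi.single b s) = 0 := by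
      have h1 : ∑ i ∈ Finset.univ \ {a, b}, |(Pi.single b s : Fin n → ℝ) i| = 0 :=
        Finset.sum_eq_zero fun i hi ↦ by
          rw [Pi.single_eq_of_ne (by grind), abs_zero]
      change ω (infDist ((Pi.single b s : Fin n → ℝ) b) cantorSet) +
        infDist ((Pi.single b s : Fin n → ℝ) b) cantorSet + _ = 0
      rw [h1, Pi.single_eq_same, (hmem s).1 hs, hω₀]
      simp
    funext i
    rw [Homeomorph.trans_apply, hxs, coordShear_apply, hq0, add_zero, Function.update_eq_self]

theorem exists_homeomorph_cube {n : ℕ} {X : Set (Fin n → ℝ)} (hX : IsCompact X)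
    {a b : Fin n} (hab : a ≠ b) (hunc : ¬((fun x ↦ x b) '' X).Countable) :
    ∃ F : (Fin n → ℝ) ≃ₜ (Fin n → ℝ),
      (∀ x ∈ X, (∀ i, F x i ∈ Ioo 0 1) ∨ ∃ s ∈ cantorSet, F x = Pi.single b s) ∧
      ∀ s ∈ cantorSet, Pi.single b s ∈ F '' X := by
  obtain ⟨F, hF, hFs⟩ := exists_homeomorph_cone hX hab hunc
  obtain ⟨R, hR⟩ := (hX.image (f := fun x ↦ F x a) (by fun_prop)).bddAbove
  set c : ℝ := 1 / (4 * max R 1) with hc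
  have hc₀ : 0 < c := by positivity
  have hcR : c * (4 * max R 1) = 1 := by rw [hc]; field_simp
  refine ⟨F.trans (coneSqueeze a b hab c hc₀.ne'), fun x hx ↦ ?_, fun s hs ↦ ?_⟩
  · obtain ⟨h1, h2⟩ := hF x hx
    have hxR : F x a ≤ max R 1 := (hR (mem_image_of_mem _ hx)).trans (le_max_left _ _)
    obtain ⟨s, hs, hds⟩ := isCompact_cantorSet.exists_infDist_eq_dist
      ⟨0, zero_mem_cantorSet⟩ (F x b)
    have hs01 := cantorSet_subset_unitInterval hs
    rw [hds, Real.dist_eq] at h1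
    simp only [Homeomorph.trans_apply]
    rcases ((abs_nonneg _).trans h1).eq_or_lt with h0 | h0
    · right
      refine ⟨s, hs, ?_⟩
      have : F x = Pi.single b s := funext fun i ↦ by
        by_cases hi : i = b
        · subst hi
          rw [← h0] at h1
          simpa [sub_eq_zero] using abs_nonpos_iff.1 h1
        · have := h2 i hi
          rw [← h0] at this
          simpa [hi] using abs_nonpos_iff.1 this
      rw [this, coneSqueeze_single]
    · left
      intro i
      have h1' := abs_le.1 h1
      have hcz : 0 < c * F x a := mul_pos hc₀ h0
      have hcz' : 4 * (c * F x a) ≤ 1 := by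
        nlinarith [mul_le_mul_of_nonneg_left hxR hc₀.le]
      simp only [coneSqueeze_apply, abs_of_pos h0]
      split_ifs with hi hi'
      · exact ⟨div_pos (by linarith [hs01.1]) (by linarith),
          (div_lt_one (by linarith)).2 (by linarith [hs01.2])⟩
      · exact ⟨hcz, by linarith⟩
      · have h3 := abs_le.1 (h2 i hi)
        exact ⟨mul_pos hc₀ (by linarith), by nlinarith⟩
  · obtain ⟨x, hx, hxs⟩ := hFs s hs
    exact ⟨x, hx, by simp [hxs, coneSqueeze_single]⟩

theorem Perfect.not_countable {E : Type*} [TopologicalSpace E] [PolishSpace E]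
    {X : Set E} (hX : Perfect X) (hne : X.Nonempty) : ¬X.Countable := by
  let := TopologicalSpace.upgradeIsCompletelyMetrizable E
  obtain ⟨f, hfX, -, hinj⟩ := hX.exists_nat_bool_injection hne
  intro h
  have := (h.mono hfX).preimage_of_injOn hinj.injOn
  rw [preimage_range, countable_univ_iff] at this
  have hle := Cardinal.mk_le_aleph0_iff.2 this
  rw [← Cardinal.power_def, Cardinal.mk_bool, Cardinal.mk_nat] at hle
  exact (Cardinal.cantor Cardinal.aleph0).not_ge hle

theorem exists_not_countable_coord {ι : Type*} [Finite ι] {X : Set (ι → ℝ)}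
    (hX : ¬X.Countable) : ∃ i, ¬((fun x ↦ x i) '' X).Countable := by
  by_contra! h
  have hsub : X ⊆ univ.pi fun i ↦ (fun x ↦ x i) '' X := fun x hx i _ ↦ ⟨x, hx, rfl⟩
  exact hX ((countable_univ_pi h).mono hsub)

theorem interior_unitCube (n : ℕ) :
    interior (unitCube n) = {x | ∀ i, x i ∈ Ioo (0 : ℝ) 1} := by
  let e := (EuclideanSpace.equiv (Fin n) ℝ).toHomeomorph
  have h : unitCube n = e ⁻¹' univ.pi fun _ ↦ Icc 0 1 := by
    ext x
    exact (mem_univ_pi (f := e x)).symm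
  rw [h, ← e.preimage_interior, interior_pi_set finite_univ]
  ext x
  simp [e]

theorem isClosed_unitCube (n : ℕ) : IsClosed (unitCube n) := by
  simp only [unitCube, ofPred_forall]
  exact isClosed_iInter fun i ↦ isClosed_Icc.preimage (by fun_prop)

/-- **Theorem 3 (Frolkina).** For any non-empty perfect compact set `X ⊆ ℝⁿ`, `n ≥ 2`,
some self-homeomorphism `F` of `ℝⁿ` satisfies `F(X) ⊆ Iⁿ` and
`F(X) ∩ ∂Iⁿ = {0}^{n-1} × 𝒞`. -/
theorem reembedding (n : ℕ) (hn : 2 ≤ n) (X : Set (EuclideanSpace ℝ (Fin n)))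
    (hne : X.Nonempty) (hperf : Perfect X) (hcpt : IsCompact X) :
    ∃ F : EuclideanSpace ℝ (Fin n) ≃ₜ EuclideanSpace ℝ (Fin n),
      F '' X ⊆ unitCube n ∧
      F '' X ∩ frontier (unitCube n) =
        {x | (∀ i : Fin n, (i : ℕ) < n - 1 → x i = 0) ∧ x ⟨n - 1, by omega⟩ ∈ cantorSet} := by
  let e := (EuclideanSpace.equiv (Fin n) ℝ).toHomeomorph
  let a : Fin n := ⟨0, by omega⟩
  let b : Fin n := ⟨n - 1, by omega⟩
  have hab : a ≠ b := by simp only [a, b, ne_eq, Fin.mk.injEq]; omega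
  have hunc : ¬(e '' X).Countable := fun h ↦ hperf.not_countable hne
    (countable_of_injective_of_countable_image e.injective.injOn h)
  obtain ⟨i, hi⟩ := exists_not_countable_coord hunc
  let σ : (Fin n → ℝ) ≃ₜ (Fin n → ℝ) :=
    Homeomorph.piCongrLeft (Y := fun _ ↦ ℝ) (Equiv.swap i b)
  have hσ : ∀ x, σ x b = x i := fun x ↦ by
    have := Homeomorph.piCongrLeft_apply_apply (Y := fun _ ↦ ℝ) (Equiv.swap i b) x i
    rwa [Equiv.swap_apply_left] at this
  obtain ⟨F, hF, hFs⟩ := exists_homeomorph_cube (X := σ '' (e '' X))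
    ((hcpt.image e.continuous).image σ.continuous) hab (by simpa only [image_image, hσ] using hi)
  let Φ := ((e.trans σ).trans F).trans e.symm
  have hΦ : ∀ x i, Φ x i = F (σ (e x)) i := fun x i ↦ rfl
  have hcases : ∀ x ∈ X, (∀ i, Φ x i ∈ Ioo 0 1) ∨
      ∃ s ∈ cantorSet, F (σ (e x)) = Pi.single b s := fun x hx ↦
    hF _ (mem_image_of_mem _ (mem_image_of_mem _ hx))
  have hsub : Φ '' X ⊆ unitCube n := by
    rintro _ ⟨x, hx, rfl⟩ i
    rcases hcases x hx with h | ⟨s, hs, h⟩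
    · exact Ioo_subset_Icc_self (h i)
    · rw [hΦ, h]
      by_cases hib : i = b
      · subst hib
        rw [Pi.single_eq_same]
        exact cantorSet_subset_unitInterval hs
      · simp [hib]
  refine ⟨Φ, hsub, ?_⟩
  rw [(isClosed_unitCube n).frontier_eq, interior_unitCube]
  ext y
  constructor
  · rintro ⟨⟨x, hx, rfl⟩, -, hnot⟩
    obtain ⟨s, hs, h⟩ := (hcases x hx).resolve_left hnot
    refine ⟨fun i hi ↦ ?_, ?_⟩
    · rw [hΦ, h, Pi.single_eq_of_ne (fun hib ↦ by simp [hib, b] at hi)]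
    · change Φ x b ∈ cantorSet
      rwa [hΦ, h, Pi.single_eq_same]
  · rintro ⟨hy0, hyb⟩
    obtain ⟨_, ⟨_, ⟨x, hx, rfl⟩, rfl⟩, hxs⟩ := hFs _ hyb
    have hxy : Φ x = y := by
      ext i
      rw [hΦ, hxs]
      by_cases hib : i = b
      · subst hib; simp [b]
      · have : (i : ℕ) ≠ n - 1 := fun h ↦ hib (Fin.ext h)
        rw [Pi.single_eq_of_ne hib, hy0 i (by omega)]
    refine ⟨⟨x, hx, hxy⟩, hsub ⟨x, hx, hxy⟩, fun hint ↦ ?_⟩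
    have := (hint a).1
    rw [hy0 a (by simp only [a]; omega)] at this
    exact lt_irrefl _ this

end
end

section
/- Suppose that for each integer k ≥ 0 we have finite families G_k and G'_k of pairwise disjoint non-empty compact subsets of ℝⁿ and ℝᵐ respectively, such that: every member of G_{k+1} is contained in some member of G_k, and every member of G'_{k+1} is contained in some member of G'_k; the cardinalities of G_k and G'_k are equal; and the meshes sup{diam A : A ∈ G_k} and sup{diam A : A ∈ G'_k} tend to 0 as k → ∞. Suppose further that for each k there is a bijection f_k : G_k → G'_k such that whenever g_k ∈ G_k, g_{k+1} ∈ G_{k+1} and g_{k+1} ⊆ g_k, one has f_{k+1}(g_{k+1}) ⊆ f_k(g_k). Then every point P of ∩_{k≥0} (∪ G_k) lies, for each k, in a unique member g_{k,P} of G_k; the set ∩_{k≥0} f_k(g_{k,P}) consists of a single point f(P); and the resulting map f is a homeomorphism of ∩_{k≥0} (∪ G_k) onto ∩_{k≥0} (∪ G'_k). -/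
open Set Topology Metric

/-- A sequence of finite families of pairwise disjoint non-empty compacta, each refining the
preceding one, with meshes tending to zero. -/
structure IsDefiningSequence {X : Type*} [MetricSpace X] (G : ℕ → Set (Set X)) : Prop where
  finite : ∀ k, (G k).Finite
  pairwise_disjoint : ∀ k, (G k).Pairwise Disjoint
  isCompact : ∀ k, ∀ A ∈ G k, IsCompact A
  nonempty : ∀ k, ∀ A ∈ G k, A.Nonempty
  refines : ∀ k, ∀ A ∈ G (k + 1), ∃ B ∈ G k, A ⊆ B
  mesh : ∀ ε > (0 : ℝ), ∃ K, ∀ k ≥ K, ∀ A ∈ G k, Metric.diam A ≤ ε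

namespace IsDefiningSequence

variable {X Y : Type*} [MetricSpace X] [MetricSpace Y] {G : ℕ → Set (Set X)}
  {G' : ℕ → Set (Set Y)} {f : ℕ → Set X → Set Y}

theorem eq_of_mem (hG : IsDefiningSequence G) {k : ℕ} {A B : Set X} (hA : A ∈ G k)
    (hB : B ∈ G k) {x : X} (hxA : x ∈ A) (hxB : x ∈ B) : A = B :=
  (hG.pairwise_disjoint k).eq hA hB (Set.not_disjoint_iff.2 ⟨x, hxA, hxB⟩)

/-- Members of consecutive families that meet are nested. -/
theorem subset_of_mem (hG : IsDefiningSequence G) {k : ℕ} {A B : Set X} (hA : A ∈ G (k + 1))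
    (hB : B ∈ G k) {x : X} (hxA : x ∈ A) (hxB : x ∈ B) : A ⊆ B := by
  obtain ⟨C, hC, hAC⟩ := hG.refines k A hA
  exact hG.eq_of_mem hC hB (hAC hxA) hxB ▸ hAC

theorem eq_of_forall_mem (hG : IsDefiningSequence G) {x y : X}
    (h : ∀ k, ∃ A ∈ G k, x ∈ A ∧ y ∈ A) : x = y := by
  refine eq_of_forall_dist_le fun ε hε => ?_
  obtain ⟨K, hK⟩ := hG.mesh ε hε
  obtain ⟨A, hA, hx, hy⟩ := h K
  exact (Metric.dist_le_diam_of_mem (hG.isCompact K A hA).isBounded hx hy).trans (hK K le_rfl A hA)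

/-- Members of `G k` are relatively open in the union of `G k`. -/
theorem eventually_mem (hG : IsDefiningSequence G) {k : ℕ} {A : Set X} (hA : A ∈ G k) {x : X}
    (hx : x ∈ A) : ∀ᶠ y in 𝓝 x, y ∈ ⋃₀ G k → y ∈ A := by
  have hclosed : IsClosed (⋃₀ (G k \ {A})) := by
    rw [sUnion_eq_biUnion]
    exact ((hG.finite k).subset sdiff_subset).isClosed_biUnion
      fun B hB => (hG.isCompact k B hB.1).isClosed
  have hx' : x ∉ ⋃₀ (G k \ {A}) := by
    rintro ⟨B, hB, hxB⟩
    exact hB.2 (hG.eq_of_mem hB.1 hA hxB hx)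
  filter_upwards [hclosed.isOpen_compl.mem_nhds hx'] with y hy ⟨B, hB, hyB⟩
  by_contra hyA
  exact hy ⟨B, ⟨hB, fun h => hyA (h ▸ hyB)⟩, hyB⟩

theorem exists_mem_of_mem (hG : IsDefiningSequence G) (hG' : IsDefiningSequence G')
    (hf : ∀ k, MapsTo (f k) (G k) (G' k))
    (hmono : ∀ k, ∀ A ∈ G k, ∀ B ∈ G (k + 1), B ⊆ A → f (k + 1) B ⊆ f k A)
    {x : X} (hx : x ∈ ⋂ k, ⋃₀ G k) :
    ∃ y ∈ ⋂ k, ⋃₀ G' k, ∀ k, ∀ A ∈ G k, x ∈ A → y ∈ f k A := by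
  choose A hA hxA using mem_iInter.1 hx
  obtain ⟨y, hy⟩ := IsCompact.nonempty_iInter_of_sequence_nonempty_isCompact_isClosed
    (fun k => f k (A k))
    (fun k => hmono k _ (hA k) _ (hA (k + 1))
      (hG.subset_of_mem (hA (k + 1)) (hA k) (hxA (k + 1)) (hxA k)))
    (fun k => hG'.nonempty k _ (hf k (hA k))) (hG'.isCompact 0 _ (hf 0 (hA 0)))
    (fun k => (hG'.isCompact k _ (hf k (hA k))).isClosed)
  rw [mem_iInter] at hy
  refine ⟨y, mem_iInter.2 fun k => ⟨_, hf k (hA k), hy k⟩, fun k B hB hxB => ?_⟩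
  rw [hG.eq_of_mem hB (hA k) hxB (hxA k)]
  exact hy k

/-- Coherent maps between defining sequences induce a continuous map of intersections. -/
theorem exists_continuous (hG : IsDefiningSequence G) (hG' : IsDefiningSequence G')
    (hf : ∀ k, MapsTo (f k) (G k) (G' k))
    (hmono : ∀ k, ∀ A ∈ G k, ∀ B ∈ G (k + 1), B ⊆ A → f (k + 1) B ⊆ f k A) :
    ∃ F : ↥(⋂ k, ⋃₀ G k) → ↥(⋂ k, ⋃₀ G' k), Continuous F ∧
      ∀ (x : ↥(⋂ k, ⋃₀ G k)) (k : ℕ), ∀ A ∈ G k, (x : X) ∈ A → (F x : Y) ∈ f k A := by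
  choose F hF hFmem using fun x : ↥(⋂ k, ⋃₀ G k) => hG.exists_mem_of_mem hG' hf hmono x.2
  refine ⟨fun x => ⟨F x, hF x⟩, ?_, hFmem⟩
  refine Continuous.subtype_mk (continuous_iff_continuousAt.2 fun x => ?_) _
  refine Metric.tendsto_nhds.2 fun ε hε => ?_
  obtain ⟨K, hK⟩ := hG'.mesh (ε / 2) (half_pos hε)
  obtain ⟨A, hA, hxA⟩ := mem_iInter.1 x.2 K
  filter_upwards [continuous_subtype_val.continuousAt.eventually (hG.eventually_mem hA hxA)]
    with y hy
  have hyA := hy (mem_iInter.1 y.2 K)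
  have hle := Metric.dist_le_diam_of_mem (hG'.isCompact K _ (hf K hA)).isBounded
    (hFmem y K A hA hyA) (hFmem x K A hA hxA)
  linarith [hK K le_rfl _ (hf K hA)]

/-- A coherent system of bijections reflects inclusions between consecutive families. -/
theorem subset_of_image_subset (hG : IsDefiningSequence G) (hG' : IsDefiningSequence G')
    (hf : ∀ k, BijOn (f k) (G k) (G' k))
    (hmono : ∀ k, ∀ A ∈ G k, ∀ B ∈ G (k + 1), B ⊆ A → f (k + 1) B ⊆ f k A)
    {k : ℕ} {A B : Set X} (hA : A ∈ G k) (hB : B ∈ G (k + 1)) (h : f (k + 1) B ⊆ f k A) :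
    B ⊆ A := by
  obtain ⟨C, hC, hBC⟩ := hG.refines k B hB
  obtain ⟨y, hy⟩ := hG'.nonempty (k + 1) _ ((hf (k + 1)).mapsTo hB)
  have hfCA : f k C = f k A := hG'.eq_of_mem ((hf k).mapsTo hC) ((hf k).mapsTo hA)
    (hmono k C hC B hB hBC hy) (h hy)
  exact (hf k).injOn hC hA hfCA ▸ hBC

/-- A coherent system of bijections between defining sequences induces a homeomorphism of
intersections. -/
theorem exists_homeomorph (hG : IsDefiningSequence G) (hG' : IsDefiningSequence G')
    (hf : ∀ k, BijOn (f k) (G k) (G' k))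
    (hmono : ∀ k, ∀ A ∈ G k, ∀ B ∈ G (k + 1), B ⊆ A → f (k + 1) B ⊆ f k A) :
    ∃ F : ↥(⋂ k, ⋃₀ G k) ≃ₜ ↥(⋂ k, ⋃₀ G' k),
      ∀ (x : ↥(⋂ k, ⋃₀ G k)) (k : ℕ), ∀ A ∈ G k, (x : X) ∈ A → (F x : Y) ∈ f k A := by
  have hinv : ∀ k, InvOn (Function.invFunOn (f k) (G k)) (f k) (G k) (G' k) :=
    fun k => (hf k).invOn_invFunOn
  have hmaps : ∀ k, MapsTo (Function.invFunOn (f k) (G k)) (G' k) (G k) :=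
    fun k => (hf k).surjOn.mapsTo_invFunOn
  obtain ⟨F, hFc, hF⟩ := hG.exists_continuous hG' (fun k => (hf k).mapsTo) hmono
  obtain ⟨E, hEc, hE⟩ := hG'.exists_continuous hG hmaps fun k A hA B hB hBA =>
    hG.subset_of_image_subset hG' hf hmono (hmaps k hA) (hmaps (k + 1) hB) <| by
      rwa [(hinv k).2 hA, (hinv (k + 1)).2 hB]
  refine ⟨⟨⟨F, E, fun x => Subtype.ext (hG.eq_of_forall_mem fun k => ?_),
    fun y => Subtype.ext (hG'.eq_of_forall_mem fun k => ?_)⟩, hFc, hEc⟩, hF⟩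
  · obtain ⟨A, hA, hxA⟩ := mem_iInter.1 x.2 k
    have h := hE (F x) k _ ((hf k).mapsTo hA) (hF x k A hA hxA)
    rw [(hinv k).1 hA] at h
    exact ⟨A, hA, h, hxA⟩
  · obtain ⟨A, hA, hyA⟩ := mem_iInter.1 y.2 k
    have h := hF (E y) k _ (hmaps k hA) (hE y k A hA hyA)
    rw [(hinv k).2 hA] at h
    exact ⟨A, hA, h, hyA⟩

end IsDefiningSequence

/-- **(Statement 4.8 in the paper, after Moise.)** Compatible systems of finite disjoint
families of compacta with meshes tending to zero, related by coherent bijections `f_k`,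
induce a homeomorphism between the intersections of their unions. -/
theorem homeomorphism_from_defining_sequences (n m : ℕ)
    (G : ℕ → Set (Set (EuclideanSpace ℝ (Fin n))))
    (G' : ℕ → Set (Set (EuclideanSpace ℝ (Fin m))))
    (f : ℕ → Set (EuclideanSpace ℝ (Fin n)) → Set (EuclideanSpace ℝ (Fin m)))
    (hGfin : ∀ k, (G k).Finite) (hG'fin : ∀ k, (G' k).Finite)
    (hGdisj : ∀ k, (G k).Pairwise Disjoint) (hG'disj : ∀ k, (G' k).Pairwise Disjoint)
    (hGcpt : ∀ k, ∀ A ∈ G k, IsCompact A ∧ A.Nonempty)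
    (hG'cpt : ∀ k, ∀ A ∈ G' k, IsCompact A ∧ A.Nonempty)
    (hGref : ∀ k, ∀ A ∈ G (k + 1), ∃ B ∈ G k, A ⊆ B)
    (hG'ref : ∀ k, ∀ A ∈ G' (k + 1), ∃ B ∈ G' k, A ⊆ B)
    (hcard : ∀ k, (G k).ncard = (G' k).ncard)
    (hmesh : ∀ ε > (0 : ℝ), ∃ K, ∀ k ≥ K, ∀ A ∈ G k, Metric.diam A ≤ ε)
    (hmesh' : ∀ ε > (0 : ℝ), ∃ K, ∀ k ≥ K, ∀ A ∈ G' k, Metric.diam A ≤ ε)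
    (hbij : ∀ k, Set.BijOn (f k) (G k) (G' k))
    (hmono : ∀ k, ∀ g ∈ G k, ∀ g' ∈ G (k + 1), g' ⊆ g → f (k + 1) g' ⊆ f k g) :
    (∀ P ∈ ⋂ k, ⋃₀ G k, ∀ k, ∃! g, g ∈ G k ∧ P ∈ g) ∧
    ∃ F : ↥(⋂ k, ⋃₀ G k) ≃ₜ ↥(⋂ k, ⋃₀ G' k),
      (∀ (P : ↥(⋂ k, ⋃₀ G k)) (k : ℕ) (g : Set (EuclideanSpace ℝ (Fin n))),
        g ∈ G k → (P : EuclideanSpace ℝ (Fin n)) ∈ g →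
          (F P : EuclideanSpace ℝ (Fin m)) ∈ f k g) ∧
      (∀ (P : ↥(⋂ k, ⋃₀ G k)) (y : EuclideanSpace ℝ (Fin m)),
        (∀ (k : ℕ) (g : Set (EuclideanSpace ℝ (Fin n))),
          g ∈ G k → (P : EuclideanSpace ℝ (Fin n)) ∈ g → y ∈ f k g) →
        y = (F P : EuclideanSpace ℝ (Fin m))) := by
  have hG : IsDefiningSequence G :=
    ⟨hGfin, hGdisj, fun k A hA => (hGcpt k A hA).1, fun k A hA => (hGcpt k A hA).2, hGref, hmesh⟩
  have hG' : IsDefiningSequence G' :=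
    ⟨hG'fin, hG'disj, fun k A hA => (hG'cpt k A hA).1, fun k A hA => (hG'cpt k A hA).2, hG'ref,
      hmesh'⟩
  refine ⟨fun P hP k => ?_, ?_⟩
  · obtain ⟨g, hg, hPg⟩ := mem_iInter.1 hP k
    exact ⟨g, ⟨hg, hPg⟩, fun h hh => hG.eq_of_mem hh.1 hg hh.2 hPg⟩
  · obtain ⟨F, hF⟩ := hG.exists_homeomorph hG' hbij hmono
    refine ⟨F, hF, fun P y hy => hG'.eq_of_forall_mem fun k => ?_⟩
    obtain ⟨g, hg, hPg⟩ := mem_iInter.1 P.2 k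
    exact ⟨f k g, (hbij k).mapsTo hg, hy k g hg hPg, hF P k g hg hPg⟩
end

section
/- Let n ≥ 2, let N = [a₁,b₁] × … × [a_n,b_n] ⊆ ℝⁿ with a_i < b_i for each i, and let p, q be points of the interior of N with λ(p) > λ(q), where λ : ℝⁿ → ℝ is the projection to the last coordinate. Then there exists a homeomorphism H of ℝⁿ onto itself such that H is the identity on ℝⁿ ∖ interior(N), H(p) = q, and for every x ∈ N with λ(x) ≥ λ(p) one has λ(H(x)) ≥ λ(q), with equality λ(H(x)) = λ(q) if and only if x = p. -/
open Set Topology Metric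

/-- The piecewise linear tent function supported on `[a, b]` with value `1` at `c`. -/
noncomputable def tent (a c b t : ℝ) : ℝ :=
  max 0 (min ((t - a) / (c - a)) ((b - t) / (b - c)))

theorem tent_nonneg (a c b t : ℝ) : 0 ≤ tent a c b t := le_max_left _ _

theorem tent_of_le_left {a c b t : ℝ} (hac : a < c) (ht : t ≤ a) : tent a c b t = 0 :=
  max_eq_left ((min_le_left _ _).trans
    (div_nonpos_of_nonpos_of_nonneg (by linarith) (by linarith)))

theorem tent_of_right_le {a c b t : ℝ} (hcb : c < b) (ht : b ≤ t) : tent a c b t = 0 :=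
  max_eq_left ((min_le_right _ _).trans
    (div_nonpos_of_nonpos_of_nonneg (by linarith) (by linarith)))

theorem tent_of_le_peak {a c b t : ℝ} (hac : a < c) (hcb : c < b) (h₁ : a ≤ t) (h₂ : t ≤ c) :
    tent a c b t = (t - a) / (c - a) := by
  have h : (t - a) / (c - a) ≤ (b - t) / (b - c) :=
    ((div_le_one (by linarith)).2 (by linarith)).trans
      ((one_le_div (by linarith)).2 (by linarith))
  rw [tent, min_eq_left h, max_eq_right (div_nonneg (by linarith) (by linarith))]

theorem tent_of_peak_le {a c b t : ℝ} (hac : a < c) (hcb : c < b) (h₁ : c ≤ t) (h₂ : t ≤ b) :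
    tent a c b t = (b - t) / (b - c) := by
  have h : (b - t) / (b - c) ≤ (t - a) / (c - a) :=
    ((div_le_one (by linarith)).2 (by linarith)).trans
      ((one_le_div (by linarith)).2 (by linarith))
  rw [tent, min_eq_right h, max_eq_right (div_nonneg (by linarith) (by linarith))]

theorem tent_of_notMem_Ioo {a c b t : ℝ} (hc : c ∈ Ioo a b) (ht : t ∉ Ioo a b) :
    tent a c b t = 0 := by
  rcases le_or_gt t a with h | h
  · exact tent_of_le_left hc.1 h
  · exact tent_of_right_le hc.2 (not_lt.1 fun h' => ht ⟨h, h'⟩)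

theorem tent_peak {a c b : ℝ} (hc : c ∈ Ioo a b) : tent a c b c = 1 := by
  rw [tent_of_le_peak hc.1 hc.2 hc.1.le le_rfl, div_self (sub_pos.2 hc.1).ne']

theorem tent_le_one {a c b : ℝ} (hc : c ∈ Ioo a b) (t : ℝ) : tent a c b t ≤ 1 := by
  refine max_le zero_le_one ?_
  rcases le_total t c with h | h
  · exact (min_le_left _ _).trans ((div_le_one (sub_pos.2 hc.1)).2 (by linarith))
  · exact (min_le_right _ _).trans ((div_le_one (sub_pos.2 hc.2)).2 (by linarith))

theorem tent_lt_one {a c b t : ℝ} (hc : c ∈ Ioo a b) (ht : t ≠ c) : tent a c b t < 1 := by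
  refine max_lt zero_lt_one ?_
  rcases lt_or_gt_of_ne ht with h | h
  · exact (min_le_left _ _).trans_lt ((div_lt_one (sub_pos.2 hc.1)).2 (by linarith))
  · exact (min_le_right _ _).trans_lt ((div_lt_one (sub_pos.2 hc.2)).2 (by linarith))

/-- Sliding the peak from `c` to `d` along the tent carries the tent at `c` to the tent at `d`. -/
theorem tent_slide {a b c d : ℝ} (hc : c ∈ Ioo a b) (hd : d ∈ Ioo a b) (t : ℝ) :
    tent a d b (t + (d - c) * tent a c b t) = tent a c b t := by
  obtain ⟨hac, hcb⟩ := hc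
  obtain ⟨had, hdb⟩ := hd
  have hca : 0 < c - a := sub_pos.2 hac
  have hbc : 0 < b - c := sub_pos.2 hcb
  have hda : 0 < d - a := sub_pos.2 had
  have hbd : 0 < b - d := sub_pos.2 hdb
  rcases le_total t a with h₁ | h₁
  · rw [tent_of_le_left hac h₁, mul_zero, add_zero, tent_of_le_left had h₁]
  rcases le_total b t with h₂ | h₂
  · rw [tent_of_right_le hcb h₂, mul_zero, add_zero, tent_of_right_le hdb h₂]
  rcases le_total t c with h | h
  · rw [tent_of_le_peak hac hcb h₁ h]
    set r := (t - a) / (c - a) with hr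
    have hr0 : 0 ≤ r := div_nonneg (by linarith) hca.le
    have hr1 : r ≤ 1 := (div_le_one hca).2 (by linarith)
    have ht : t = a + r * (c - a) := by rw [hr]; field_simp; ring
    have e : t + (d - c) * r = a + r * (d - a) := by rw [ht]; ring
    rw [e, tent_of_le_peak had hdb (by nlinarith) (by nlinarith)]
    field_simp
    ring
  · rw [tent_of_peak_le hac hcb h h₂]
    set r := (b - t) / (b - c) with hr
    have hr0 : 0 ≤ r := div_nonneg (by linarith) hbc.le
    have hr1 : r ≤ 1 := (div_le_one hbc).2 (by linarith)
    have ht : t = b - r * (b - c) := by rw [hr]; field_simp; ring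
    have e : t + (d - c) * r = b - r * (b - d) := by rw [ht]; ring
    rw [e, tent_of_peak_le had hdb (by nlinarith) (by nlinarith)]
    field_simp
    ring

theorem lt_slide {a b c d t : ℝ} (hc : c ∈ Ioo a b) (hd : d ∈ Ioo a b) (ht : c < t) :
    d < t + (d - c) * tent a c b t := by
  have hcb := hc.2
  have hdb := hd.2
  rcases le_total b t with h | h
  · rw [tent_of_right_le hcb h]
    linarith
  · have hbc : 0 < b - c := sub_pos.2 hcb
    rw [tent_of_peak_le hc.1 hcb ht.le h]
    have e : t + (d - c) * ((b - t) / (b - c)) = d + (b - d) * (t - c) / (b - c) := by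
      field_simp
      ring
    have : 0 < (b - d) * (t - c) / (b - c) :=
      div_pos (mul_pos (by linarith) (by linarith)) hbc
    linarith

theorem Continuous.tent {X : Type*} [TopologicalSpace X] {a b : ℝ} {s f : X → ℝ}
    (hs : Continuous s) (hf : Continuous f) (hsab : ∀ x, s x ∈ Ioo a b) :
    Continuous fun x => tent a (s x) b (f x) := by
  refine continuous_const.max (Continuous.min ?_ ?_)
  · exact (hf.sub continuous_const).div (hs.sub continuous_const)
      fun x => (sub_pos.2 (hsab x).1).ne'
  · exact (continuous_const.sub hf).div (continuous_const.sub hs)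
      fun x => (sub_pos.2 (hsab x).2).ne'

section Slide

variable {ι : Type*} [DecidableEq ι]

/-- Slide the `i`-th coordinate inside `[a, b]` so that the value `s x` is carried to `r x`. -/
noncomputable def slide (i : ι) (a b : ℝ) (s r : (ι → ℝ) → ℝ) (x : ι → ℝ) : ι → ℝ :=
  Function.update x i (x i + (r x - s x) * tent a (s x) b (x i))

theorem slide_slide {i : ι} {a b : ℝ} {s r : (ι → ℝ) → ℝ}
    (hs : ∀ x, s x ∈ Ioo a b) (hr : ∀ x, r x ∈ Ioo a b)
    (hsi : ∀ x t, s (Function.update x i t) = s x)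
    (hri : ∀ x t, r (Function.update x i t) = r x) (x : ι → ℝ) :
    slide i a b r s (slide i a b s r x) = x := by
  have h := tent_slide (hs x) (hr x) (x i)
  simp only [slide, hsi, hri, Function.update_self, Function.update_idem, h]
  convert Function.update_eq_self i x using 2
  ring

theorem continuous_slide {i : ι} {a b : ℝ} {s r : (ι → ℝ) → ℝ}
    (hs : ∀ x, s x ∈ Ioo a b) (hsc : Continuous s) (hrc : Continuous r) :
    Continuous (slide i a b s r) :=
  continuous_id.update i ((continuous_apply i).add
    ((hrc.sub hsc).mul (hsc.tent (continuous_apply i) hs)))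

/-- `slide` as a homeomorphism, for `s` and `r` independent of the `i`-th coordinate. -/
noncomputable def slideHomeomorph (i : ι) (a b : ℝ) (s r : (ι → ℝ) → ℝ)
    (hs : ∀ x, s x ∈ Ioo a b) (hr : ∀ x, r x ∈ Ioo a b)
    (hsi : ∀ x t, s (Function.update x i t) = s x)
    (hri : ∀ x t, r (Function.update x i t) = r x)
    (hsc : Continuous s) (hrc : Continuous r) : (ι → ℝ) ≃ₜ (ι → ℝ) where
  toFun := slide i a b s r
  invFun := slide i a b r s
  left_inv := slide_slide hs hr hsi hri
  right_inv := slide_slide hr hs hri hsi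
  continuous_toFun := continuous_slide hs hsc hrc
  continuous_invFun := continuous_slide hr hrc hsc

variable [Fintype ι]

/-- A point of an open box can be moved along one coordinate by a homeomorphism supported in the
box which preserves the other coordinates; when the point is moved down, it is the only point
of its upper half space that reaches its new level. -/
theorem exists_homeomorph_update {a b p : ι → ℝ} (hp : ∀ j, p j ∈ Ioo (a j) (b j)) (i : ι)
    {v : ℝ} (hv : v ∈ Ioo (a i) (b i)) :
    ∃ H : (ι → ℝ) ≃ₜ (ι → ℝ), (∀ x, (∃ j, x j ∉ Ioo (a j) (b j)) → H x = x) ∧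
      H p = Function.update p i v ∧ (∀ x, ∀ j ≠ i, H x j = x j) ∧
      (v < p i → ∀ x, p i ≤ x i → x ≠ p → v < H x i) := by
  set β : (ι → ℝ) → ℝ := fun x => ∏ j ∈ Finset.univ.erase i, tent (a j) (p j) (b j) (x j)
    with hβ
  set r : (ι → ℝ) → ℝ := fun x => p i + (v - p i) * β x with hr
  have β_nonneg (x) : 0 ≤ β x := Finset.prod_nonneg fun j _ => tent_nonneg ..
  have β_le_one (x) : β x ≤ 1 :=
    Finset.prod_le_one (fun j _ => tent_nonneg ..) fun j _ => tent_le_one (hp j) _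
  have β_eq_zero {x j} (hj : j ≠ i) (hx : x j ∉ Ioo (a j) (b j)) : β x = 0 :=
    Finset.prod_eq_zero (Finset.mem_erase.2 ⟨hj, Finset.mem_univ j⟩)
      (tent_of_notMem_Ioo (hp j) hx)
  have β_p : β p = 1 := Finset.prod_eq_one fun j _ => tent_peak (hp j)
  have β_lt_one {x j} (hj : j ≠ i) (hx : x j ≠ p j) : β x < 1 := by
    have hmem : j ∈ Finset.univ.erase i := Finset.mem_erase.2 ⟨hj, Finset.mem_univ j⟩
    rw [hβ]
    beta_reduce
    rw [← Finset.mul_prod_erase _ _ hmem]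
    refine lt_of_le_of_lt (mul_le_of_le_one_right (tent_nonneg ..) ?_) (tent_lt_one (hp j) hx)
    exact Finset.prod_le_one (fun j _ => tent_nonneg ..) fun j _ => tent_le_one (hp j) _
  have β_update (x t) : β (Function.update x i t) = β x :=
    Finset.prod_congr rfl fun j hj => by rw [Function.update_of_ne (Finset.ne_of_mem_erase hj)]
  have β_cont : Continuous β := continuous_finsetProd _ fun j _ =>
    continuous_const.tent (continuous_apply j) fun _ => hp j
  have r_mem (x) : r x ∈ Ioo (a i) (b i) := by
    have := convex_Ioo (a i) (b i) (hp i) hv (sub_nonneg.2 (β_le_one x)) (β_nonneg x) (by ring)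
    convert this using 1
    simp only [hr, smul_eq_mul]
    ring
  refine ⟨slideHomeomorph i (a i) (b i) (fun _ => p i) r (fun _ => hp i) r_mem (fun _ _ => rfl)
    (fun x t => by simp only [hr, β_update]) continuous_const
    (continuous_const.add (continuous_const.mul β_cont)), ?_, ?_, ?_, ?_⟩
  · rintro x ⟨j, hj⟩
    have h : (r x - p i) * tent (a i) (p i) (b i) (x i) = 0 := by
      rcases eq_or_ne j i with rfl | hji
      · rw [tent_of_notMem_Ioo (hp j) hj, mul_zero]
      · simp only [hr, β_eq_zero hji hj, mul_zero, add_zero, sub_self, zero_mul]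
    change slide i (a i) (b i) (fun _ => p i) r x = x
    rw [slide, h, add_zero, Function.update_eq_self]
  · change slide i (a i) (b i) (fun _ => p i) r p = _
    rw [slide, tent_peak (hp i)]
    simp [hr, β_p]
  · exact fun x j hj => Function.update_of_ne hj _ _
  · intro hvp x hx hxp
    change v < slide i (a i) (b i) (fun _ => p i) r x i
    rw [slide, Function.update_self]
    have hvr : v ≤ r x := by
      simp only [hr]
      nlinarith [β_le_one x]
    rcases hx.lt_or_eq with h | h
    · exact hvr.trans_lt (lt_slide (hp i) (r_mem x) h)
    · obtain ⟨j, hj⟩ := Function.ne_iff.1 hxp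
      have hji : j ≠ i := by
        rintro rfl
        exact hj h.symm
      have := β_lt_one hji hj
      rw [← h, tent_peak (hp i)]
      simp only [hr]
      nlinarith

/-- If two points of an open box differ only in the coordinates in `S`, then the first is carried
to the second by a homeomorphism supported in the box and preserving the other coordinates. -/
theorem exists_homeomorph_of_eq_off {a b q : ι → ℝ} (hq : ∀ j, q j ∈ Ioo (a j) (b j))
    (S : Finset ι) : ∀ p : ι → ℝ, (∀ j, p j ∈ Ioo (a j) (b j)) → (∀ j ∉ S, p j = q j) →
    ∃ H : (ι → ℝ) ≃ₜ (ι → ℝ), (∀ x, (∃ j, x j ∉ Ioo (a j) (b j)) → H x = x) ∧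
      H p = q ∧ ∀ x, ∀ j ∉ S, H x j = x j := by
  induction S using Finset.induction_on with
  | empty =>
    intro p _ hpq
    exact ⟨Homeomorph.refl _, fun _ _ => rfl, funext fun j => hpq j (Finset.notMem_empty j),
      fun _ _ _ => rfl⟩
  | insert i S _ ih =>
    intro p hp hpq
    obtain ⟨F, hF, hFp, hFj, -⟩ := exists_homeomorph_update hp i (hq i)
    obtain ⟨G, hG, hGp, hGj⟩ := ih (Function.update p i (q i))
      (fun j => by rcases eq_or_ne j i with rfl | h <;> simp [*, -mem_Ioo])
      (fun j hj => by
        rcases eq_or_ne j i with rfl | h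
        · simp
        · simp [h, hpq j (by simp [h, hj])])
    refine ⟨F.trans G, fun x hx => ?_, ?_, fun x j hj => ?_⟩
    · rw [Homeomorph.trans_apply, hF x hx, hG x hx]
    · rw [Homeomorph.trans_apply, hFp, hGp]
    · rw [Finset.mem_insert, not_or] at hj
      rw [Homeomorph.trans_apply, hGj _ j hj.2, hFj x j hj.1]

/-- A point of an open box can be pushed down to any point of a lower level by a homeomorphism
supported in the box, so that no other point of its upper half space reaches that level. -/
theorem exists_homeomorph_push_down {a b p q : ι → ℝ} (hp : ∀ j, p j ∈ Ioo (a j) (b j))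
    (hq : ∀ j, q j ∈ Ioo (a j) (b j)) (i : ι) (hpq : q i < p i) :
    ∃ H : (ι → ℝ) ≃ₜ (ι → ℝ), (∀ x, (∃ j, x j ∉ Ioo (a j) (b j)) → H x = x) ∧
      H p = q ∧ ∀ x, p i ≤ x i → x ≠ p → q i < H x i := by
  obtain ⟨F, hF, hFp, -, hFi⟩ := exists_homeomorph_update hp i (hq i)
  obtain ⟨G, hG, hGp, hGj⟩ := exists_homeomorph_of_eq_off hq (Finset.univ.erase i)
    (Function.update p i (q i))
    (fun j => by rcases eq_or_ne j i with rfl | h <;> simp [*, -mem_Ioo])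
    (fun j hj => by
      obtain rfl : j = i := by simpa using hj
      simp)
  refine ⟨F.trans G, fun x hx => ?_, ?_, fun x hx hxp => ?_⟩
  · rw [Homeomorph.trans_apply, hF x hx, hG x hx]
  · rw [Homeomorph.trans_apply, hFp, hGp]
  · rw [Homeomorph.trans_apply, hGj _ i (Finset.notMem_erase i _)]
    exact hFi hpq x hx hxp

end Slide

theorem EuclideanSpace.mem_interior_box {ι : Type*} [Fintype ι] (a b : ι → ℝ)
    (x : EuclideanSpace ℝ ι) :
    x ∈ interior {x : EuclideanSpace ℝ ι | ∀ i, x i ∈ Icc (a i) (b i)} ↔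
      ∀ i, x i ∈ Ioo (a i) (b i) := by
  let e := (EuclideanSpace.equiv ι ℝ).toHomeomorph
  have h : {x : EuclideanSpace ℝ ι | ∀ i, x i ∈ Icc (a i) (b i)} =
      e ⁻¹' Set.pi univ fun i => Icc (a i) (b i) := by
    ext y
    simp only [mem_preimage, mem_univ_pi]
    rfl
  rw [h, ← e.preimage_interior, interior_pi_set finite_univ]
  simp only [interior_Icc, mem_preimage, mem_univ_pi]
  rfl

/-- **Lemma 5.1 (Frolkina).** Given an `n`-cube `N` and interior points `p, q` with
`λ(p) > λ(q)` (`λ` = last coordinate), there is a self-homeomorphism `H` of `ℝⁿ` which is the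
identity off the interior of `N`, sends `p` to `q`, and for every `x ∈ N` with `λ(x) ≥ λ(p)`
satisfies `λ(H(x)) ≥ λ(q)`, with equality exactly for `x = p`. -/
theorem pushing_down_lemma (n : ℕ) (hn : 2 ≤ n) (a b : Fin n → ℝ) (hab : ∀ i, a i < b i)
    (p q : EuclideanSpace ℝ (Fin n))
    (hp : p ∈ interior {x : EuclideanSpace ℝ (Fin n) | ∀ i, x i ∈ Set.Icc (a i) (b i)})
    (hq : q ∈ interior {x : EuclideanSpace ℝ (Fin n) | ∀ i, x i ∈ Set.Icc (a i) (b i)})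
    (hpq : q ⟨n - 1, by omega⟩ < p ⟨n - 1, by omega⟩) :
    ∃ H : EuclideanSpace ℝ (Fin n) ≃ₜ EuclideanSpace ℝ (Fin n),
      (∀ x ∉ interior {x : EuclideanSpace ℝ (Fin n) | ∀ i, x i ∈ Set.Icc (a i) (b i)},
        H x = x) ∧
      H p = q ∧
      ∀ x ∈ {x : EuclideanSpace ℝ (Fin n) | ∀ i, x i ∈ Set.Icc (a i) (b i)},
        p ⟨n - 1, by omega⟩ ≤ x ⟨n - 1, by omega⟩ →
          q ⟨n - 1, by omega⟩ ≤ H x ⟨n - 1, by omega⟩ ∧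
          (H x ⟨n - 1, by omega⟩ = q ⟨n - 1, by omega⟩ ↔ x = p) := by
  simp only [EuclideanSpace.mem_interior_box] at hp hq ⊢
  obtain ⟨H, hH, hHp, hHlt⟩ := exists_homeomorph_push_down (p := fun j => p j)
    (q := fun j => q j) hp hq ⟨n - 1, by omega⟩ hpq
  let e := (EuclideanSpace.equiv (Fin n) ℝ).toHomeomorph
  have key : (e.trans (H.trans e.symm)) p = q := congrArg e.symm hHp
  refine ⟨e.trans (H.trans e.symm), fun x hx => ?_, key, fun x _ hpx => ?_⟩
  · exact (congrArg e.symm (hH (e x) (not_forall.1 hx))).trans (e.symm_apply_apply x)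
  · rcases eq_or_ne x p with rfl | hxp
    · rw [key]
      simp
    · have h : q ⟨n - 1, by omega⟩ < (e.trans (H.trans e.symm)) x ⟨n - 1, by omega⟩ :=
        hHlt (e x) hpx fun h => hxp (e.injective h)
      exact ⟨h.le, fun h' => absurd h' h.ne', fun h' => absurd h' hxp⟩
end

section
/- Let X ⊆ ℝⁿ be a non-empty compact set, n ≥ 2. Then there exists a homeomorphism h of ℝⁿ onto itself such that h(X) ⊆ Iⁿ and h(X) ∩ ∂Iⁿ is a single point belonging to (0,1)^{n−1} × {0}. -/
open Set Topology Metric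

noncomputable section

/-- The shear `x ↦ x + φ x • v` is a homeomorphism when `φ` is continuous and constant
along the direction `v`. -/
def shearHomeomorph {E : Type*} [AddCommGroup E] [Module ℝ E] [TopologicalSpace E]
    [IsTopologicalAddGroup E] [ContinuousSMul ℝ E] (φ : E → ℝ) (v : E) (hφ : Continuous φ)
    (hv : ∀ x (t : ℝ), φ (x + t • v) = φ x) : E ≃ₜ E where
  toFun x := x + φ x • v
  invFun x := x - φ x • v
  left_inv x := by simp [hv]
  right_inv x := by
    have h : φ (x - φ x • v) = φ x := by simpa [sub_eq_add_neg] using hv x (-φ x)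
    simp [h]
  continuous_toFun := by fun_prop
  continuous_invFun := by fun_prop

/-- A self-homeomorphism of `ℝⁿ` moves some point of a non-empty compact set to the origin and
all of its other points into the open half-space where the coordinate `l` is positive. -/
theorem exists_homeomorph_strictly_above {n : ℕ} (l : Fin n)
    {X : Set (EuclideanSpace ℝ (Fin n))} (hne : X.Nonempty) (hcpt : IsCompact X) :
    ∃ g : EuclideanSpace ℝ (Fin n) ≃ₜ EuclideanSpace ℝ (Fin n), ∃ p ∈ X,
      g p = 0 ∧ ∀ x ∈ X, x ≠ p → 0 < g x l := by
  obtain ⟨p, hp, hmin⟩ := hcpt.exists_isMinOn hne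
    (f := fun x : EuclideanSpace ℝ (Fin n) => x l) (by fun_prop)
  let φ : EuclideanSpace ℝ (Fin n) → ℝ := fun x => ∑ i ∈ Finset.univ.erase l, x i ^ 2
  have hφ : Continuous φ := by fun_prop
  have hv : ∀ x (t : ℝ), φ (x + t • EuclideanSpace.single l 1) = φ x := by
    intro x t
    refine Finset.sum_congr rfl fun i hi => ?_
    simp [Finset.ne_of_mem_erase hi]
  refine ⟨(Homeomorph.subRight p).trans (shearHomeomorph φ _ hφ hv), p, hp, ?_, ?_⟩
  · simp [shearHomeomorph, φ]
  · intro x hx hxp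
    have hle : p l ≤ x l := hmin hx
    have hval : ((Homeomorph.subRight p).trans (shearHomeomorph φ _ hφ hv)) x l =
        (x l - p l) + φ (x - p) := by
      simp [shearHomeomorph]
    rw [hval]
    have hφ0 : 0 ≤ φ (x - p) := Finset.sum_nonneg fun i _ => sq_nonneg _
    rcases hle.lt_or_eq with hlt | heq
    · linarith
    · obtain ⟨i, hi⟩ : ∃ i, x i ≠ p i := by
        by_contra! hall
        exact hxp (by ext i; exact hall i)
      have hil : i ≠ l := by
        rintro rfl
        exact hi heq.symm
      have hpos : 0 < φ (x - p) := by
        refine Finset.sum_pos' (fun i _ => sq_nonneg _) ⟨i, by simp [hil], ?_⟩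
        have : (x - p) i ≠ 0 := by simpa [sub_eq_zero] using hi
        positivity
      linarith

/-- **Lemma 5.2 (Frolkina).** Every non-empty compact `X ⊆ ℝⁿ`, `n ≥ 2`, can be moved by a
self-homeomorphism of `ℝⁿ` into `Iⁿ` so that it meets `∂Iⁿ` in a single point of
`(0,1)^{n-1} × {0}`. -/
theorem into_cube_single_boundary_point (n : ℕ) (hn : 2 ≤ n)
    (X : Set (EuclideanSpace ℝ (Fin n))) (hne : X.Nonempty) (hcpt : IsCompact X) :
    ∃ h : EuclideanSpace ℝ (Fin n) ≃ₜ EuclideanSpace ℝ (Fin n),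
      h '' X ⊆ unitCube n ∧
      ∃ p ∈ openFace n, h '' X ∩ frontier (unitCube n) = {p} := by
  let l : Fin n := ⟨n - 1, by omega⟩
  have hl : ∀ i : Fin n, (i : ℕ) = n - 1 ↔ i = l := fun i => by simp [l, Fin.ext_iff]
  obtain ⟨g, p, hp, hgp, hpos⟩ := exists_homeomorph_strictly_above l hne hcpt
  obtain ⟨C, hC, hbd⟩ := (hcpt.image g.continuous).isBounded.exists_pos_norm_le
  let s : ℝ := 1 / (4 * C)
  have hs : 0 < s := by positivity
  let c : EuclideanSpace ℝ (Fin n) := WithLp.toLp 2 fun i => if i = l then 0 else 1 / 2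
  let h := g.trans ((Homeomorph.smulOfNeZero s hs.ne').trans (Homeomorph.addRight c))
  have hval : ∀ x i, h x i = s * g x i + if i = l then 0 else 1 / 2 := by
    intro x i
    simp [h, c]
  have hsmall : ∀ x ∈ X, ∀ i, |s * g x i| ≤ 1 / 4 := by
    intro x hx i
    have h1 : |g x i| ≤ C := by
      simpa using (PiLp.norm_apply_le (g x) i).trans (hbd _ (mem_image_of_mem g hx))
    rw [abs_mul, abs_of_pos hs]
    calc s * |g x i| ≤ s * C := by gcongr
      _ = 1 / 4 := by simp only [s]; field_simp
  have hside : ∀ x ∈ X, ∀ i, i ≠ l → h x i ∈ Ioo (0 : ℝ) 1 := by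
    intro x hx i hi
    have := abs_le.1 (hsmall x hx i)
    rw [hval, if_neg hi]
    constructor <;> linarith
  have hinner : ∀ x ∈ X, x ≠ p → h x ∈ interior (unitCube n) := by
    intro x hx hxp
    rw [interior_unitCube]
    intro i
    by_cases hi : i = l
    · have h1 := abs_le.1 (hsmall x hx i)
      have h2 := mul_pos hs (hpos x hx hxp)
      rw [hval, if_pos hi]
      subst hi
      constructor <;> linarith
    · exact hside x hx i hi
  have hpl : h p l = 0 := by simp [hval, hgp]
  have hpcube : h p ∈ unitCube n := by
    intro i
    by_cases hi : i = l
    · rw [hi, hpl]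
      simp
    · exact Ioo_subset_Icc_self (hside p hp i hi)
  refine ⟨h, ?_, h p, ⟨fun i hi => ?_, fun i hi => ?_⟩, ?_⟩
  · rintro _ ⟨x, hx, rfl⟩
    by_cases hxp : x = p
    · rwa [hxp]
    · exact interior_subset (hinner x hx hxp)
  · exact hside p hp i fun hil => hi.ne ((hl i).2 hil)
  · rw [(hl i).1 hi, hpl]
  · rw [(isClosed_unitCube n).frontier_eq]
    ext y
    constructor
    · rintro ⟨⟨x, hx, rfl⟩, -, hy⟩
      by_contra hne'
      exact hy (hinner x hx fun hxp => hne' (by rw [hxp]; rfl))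
    · rintro rfl
      refine ⟨mem_image_of_mem h hp, hpcube, fun hint => ?_⟩
      rw [interior_unitCube] at hint
      exact (hint l).1.ne' hpl

end
end

section
/- Let n ≥ 2 and let X ⊆ Iⁿ be a non-empty perfect compact set with X ∩ ∂Iⁿ = {p₁, …, p_k}, a finite set of distinct points contained in (0,1)^{n−1} × {0}. For each i let N_i be an n-cube neighborhood of p_i in ℝⁿ such that π(N_i) ⊆ [0,1]^{n−1} and N_i ∩ N_j = ∅ for i ≠ j, where π : ℝⁿ → ℝ^{n−1} is the projection forgetting the last coordinate. Then there exists a homeomorphism h of ℝⁿ onto itself such that: h is the identity outside ⋃_{i=1}^k N_i; h(X) ⊆ Iⁿ; and h(X) ∩ ∂Iⁿ = {p₁, q₁, p₂, q₂, …, p_k, q_k}, where for each i the point q_i belongs to π(interior N_i) × {0} and q_i ≠ p_i. -/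
open Set Topology Metric

noncomputable section

/-- An `n`-cube neighborhood of a point `p`: a product of nondegenerate closed intervals
containing `p` in its interior. -/
def IsCubeNbhd {n : ℕ} (N : Set (EuclideanSpace ℝ (Fin n))) (p : EuclideanSpace ℝ (Fin n)) :
    Prop :=
  (∃ a b : Fin n → ℝ, (∀ i, a i < b i) ∧ N = {x | ∀ i, x i ∈ Set.Icc (a i) (b i)}) ∧
  p ∈ interior N

/-- A continuous perturbation of the identity along a fixed direction which is contracting on
every line in that direction is a homeomorphism. -/
theorem exists_homeomorph_sub_smul {E : Type*} [NormedAddCommGroup E] [NormedSpace ℝ E]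
    {φ : E → ℝ} (hφ : Continuous φ) (v : E) {c : NNReal} (hc : c < 1)
    (hlip : ∀ x, LipschitzWith c fun t : ℝ => φ (x + t • v)) :
    ∃ h : E ≃ₜ E, ∀ x, h x = x - φ x • v := by
  have hcon : ∀ x, ContractingWith c fun t : ℝ => φ (x + t • v) := fun x => ⟨hc, hlip x⟩
  have hc' : (0 : ℝ) < 1 - c := by
    have : (c : ℝ) < 1 := by exact_mod_cast hc
    linarith
  set T : E → ℝ := fun y => (hcon y).fixedPoint with hT
  have hfix : ∀ y, φ (y + T y • v) = T y := fun y => (hcon y).fixedPoint_isFixedPt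
  have huniq : ∀ y t, φ (y + t • v) = t → t = T y := fun y t ht =>
    (hcon y).fixedPoint_unique ht
  have hTcont : Continuous T := by
    rw [continuous_iff_continuousAt]
    intro y
    have key : ∀ z, dist (T z) (T y) ≤ (1 - (c : ℝ))⁻¹ * dist (φ (z + T y • v)) (T y) := by
      intro z
      have h1 : dist (T z) (φ (z + T y • v)) ≤ c * dist (T z) (T y) := by
        have := (hlip z).dist_le_mul (T z) (T y)
        simpa only [hfix] using this
      have h2 := dist_triangle (T z) (φ (z + T y • v)) (T y)
      rw [inv_mul_eq_div, le_div_iff₀ hc']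
      linarith
    have hlim : Filter.Tendsto (fun z => (1 - (c : ℝ))⁻¹ * dist (φ (z + T y • v)) (T y))
        (𝓝 y) (𝓝 0) := by
      have hcont : Continuous fun z => (1 - (c : ℝ))⁻¹ * dist (φ (z + T y • v)) (T y) := by
        fun_prop
      have := hcont.tendsto y
      simpa [hfix] using this
    exact tendsto_iff_dist_tendsto_zero.2
      (squeeze_zero (fun _ => dist_nonneg) key hlim)
  refine ⟨{ toFun := fun x => x - φ x • v
            invFun := fun y => y + T y • v
            left_inv := fun x => ?_
            right_inv := fun y => ?_
            continuous_toFun := by fun_prop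
            continuous_invFun := by fun_prop }, fun x => rfl⟩
  · have : φ x = T (x - φ x • v) := huniq _ _ (by simp)
    simp [← this]
  · simp [hfix]

theorem mem_frontier_unitCube_iff {n : ℕ} {x : EuclideanSpace ℝ (Fin n)} (hx : x ∈ unitCube n) :
    x ∈ frontier (unitCube n) ↔ ¬ ∀ i, x i ∈ Ioo (0 : ℝ) 1 := by
  rw [frontier, interior_unitCube]
  simp only [mem_sdiff, mem_ofPred_eq, subset_closure hx, true_and]

/-- If a compact subset of the unit cube touches the boundary at `p`, in the open face, and
accumulates there, then a homeomorphism supported near `p` adds exactly one point to the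
intersection with the boundary. -/
theorem exists_feeler {n : ℕ} {d e : Fin n} (hd : (d : ℕ) = n - 1) (hed : e ≠ d)
    {Y N : Set (EuclideanSpace ℝ (Fin n))} {p : EuclideanSpace ℝ (Fin n)}
    (hY : IsCompact Y) (hYI : Y ⊆ unitCube n) (hp : p ∈ openFace n)
    (hacc : AccPt p (Filter.principal Y)) (hN : N ∈ 𝓝 p)
    (hbd : ∀ y ∈ Y, y ∈ frontier (unitCube n) → y ∈ N → y = p) :
    ∃ (h : EuclideanSpace ℝ (Fin n) ≃ₜ EuclideanSpace ℝ (Fin n))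
      (q : EuclideanSpace ℝ (Fin n)), (∀ x ∉ N, h x = x) ∧ h '' Y ⊆ unitCube n ∧
      q ∈ interior N ∧ q ≠ p ∧ q d = 0 ∧
      h '' Y ∩ frontier (unitCube n) = (Y ∩ frontier (unitCube n)) ∪ {q} := by
  have hpd : p d = 0 := hp.2 d hd
  have hlt : ∀ i : Fin n, i ≠ d → (i : ℕ) < n - 1 := fun i hi => by
    have := i.2
    have : (i : ℕ) ≠ d := fun h => hi (Fin.ext h)
    omega
  obtain ⟨ε, hε, hball⟩ : ∃ ε > 0, ball p ε ⊆
      interior N ∩ {x | (∀ i, i ≠ d → x i ∈ Ioo (0 : ℝ) 1) ∧ x d < 1} := by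
    refine Metric.mem_nhds_iff.1 (Filter.inter_mem (interior_mem_nhds.2 hN) ?_)
    refine Filter.Eventually.and ?_ ?_
    · refine Filter.eventually_all.2 fun i => ?_
      by_cases hi : i = d
      · simp [hi]
      · have hc : Continuous fun x : EuclideanSpace ℝ (Fin n) => x i := by fun_prop
        filter_upwards [hc.continuousAt.eventually_mem
          (isOpen_Ioo.mem_nhds (hp.1 i (hlt i hi)))] with x hx _ using hx
    · have hc : Continuous fun x : EuclideanSpace ℝ (Fin n) => x d := by fun_prop
      exact hc.continuousAt.eventually_mem (isOpen_Iio.mem_nhds (by simp [hpd]))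
  have hYd : ∀ y ∈ Y, y ∈ ball p ε → y ≠ p → 0 < y d := by
    intro y hy hyb hyp
    have : y ∉ frontier (unitCube n) := fun h =>
      hyp (hbd y hy h (interior_subset (hball hyb).1))
    rw [mem_frontier_unitCube_iff (hYI hy), not_not] at this
    exact (this d).1
  have hcoord : ∀ x y : EuclideanSpace ℝ (Fin n), |x d - y d| ≤ dist x y := fun x y => by
    rw [dist_eq_norm]
    exact PiLp.norm_apply_le (x - y) d
  set η := ε / 16 with hη
  have hη0 : 0 < η := by positivity
  obtain ⟨s, ⟨hsb, hsY⟩, hsp⟩ := accPt_iff_nhds.1 hacc _ (ball_mem_nhds p (half_pos hη0))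
  rw [mem_ball] at hsb
  have hsd : 0 < s d := hYd s hsY (mem_ball.2 (by linarith)) hsp
  have hsd' : s d ≤ dist s p := by
    have := hcoord s p
    rwa [hpd, sub_zero, abs_of_pos hsd] at this
  -- a direction that separates the projections of `s` and `p` to the hyperplane
  obtain ⟨v, hvd, hv2, hvs⟩ : ∃ v : EuclideanSpace ℝ (Fin n),
      v d = 1 ∧ ‖v‖ ≤ 2 ∧ s - s d • v ≠ p := by
    by_cases hs : s - s d • EuclideanSpace.single d (1 : ℝ) = p
    · refine ⟨EuclideanSpace.single d 1 + EuclideanSpace.single e 1, ?_, ?_, fun h => ?_⟩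
      · simp [hed.symm]
      · refine (norm_add_le _ _).trans ?_
        norm_num [PiLp.norm_single]
      · have h1 : s d • EuclideanSpace.single e (1 : ℝ) = 0 := by
          rw [smul_add, ← sub_sub, hs] at h
          simpa using h
        have h2 := congrArg (fun x : EuclideanSpace ℝ (Fin n) => x e) h1
        simp at h2
        exact hsd.ne' h2
    · exact ⟨EuclideanSpace.single d 1, by simp, by norm_num [PiLp.norm_single], hs⟩
  set w : EuclideanSpace ℝ (Fin n) → EuclideanSpace ℝ (Fin n) := fun x => x - x d • v with hw
  have hwc : Continuous w := by fun_prop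
  have hwp : w p = p := by simp [hw, hpd]
  have hwv : ∀ x (t : ℝ), w (x + t • v) = w x := fun x t => by
    simp only [hw, PiLp.add_apply, PiLp.smul_apply, hvd, smul_eq_mul, mul_one, add_smul]
    abel
  have hdist_w : ∀ x, dist x (w x) ≤ |x d| * 2 := fun x => by
    simp only [hw, dist_eq_norm, sub_sub_cancel, norm_smul, Real.norm_eq_abs]
    gcongr
  set ρ := dist (w s) p / 2 with hρ
  have hρ0 : 0 < ρ := half_pos (dist_pos.2 hvs)
  have hρs : dist (w s) p ≤ 3 * dist s p := by
    have h1 := dist_triangle (w s) s p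
    have h2 := hdist_w s
    rw [abs_of_pos hsd, dist_comm] at h2
    linarith
  set K := {x : EuclideanSpace ℝ (Fin n) | |x d| ≤ 2 * η ∧ dist (w x) (w s) ≤ ρ} with hK
  have hKball : ∀ x ∈ K, dist x p < 7 * η := by
    rintro x ⟨hx1, hx2⟩
    have h1 := dist_triangle4 x (w x) (w s) p
    have h2 := hdist_w x
    linarith
  have hKsub : ∀ x ∈ K, x ∈ ball p ε := fun x hx => mem_ball.2 (by linarith [hKball x hx])
  have hpK : p ∉ K := fun h => by
    have := h.2
    rw [hwp, dist_comm] at this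
    linarith
  have hKd : ∀ x ∈ Y ∩ K, 0 < x d := fun x hx =>
    hYd x hx.1 (hKsub x hx.2) fun h => hpK (h ▸ hx.2)
  have hYK : IsCompact (Y ∩ K) := by
    refine hY.inter_right (IsClosed.inter ?_ ?_)
    · exact isClosed_le (f := fun x : EuclideanSpace ℝ (Fin n) => |x d|) (by fun_prop)
        continuous_const
    · exact isClosed_le (f := fun x => dist (w x) (w s)) (by fun_prop) continuous_const
  have hsK : s ∈ Y ∩ K := ⟨hsY, by rw [abs_of_pos hsd]; linarith, by simp [hρ0.le]⟩
  set b : EuclideanSpace ℝ (Fin n) → ℝ := fun z => max 0 (ρ - dist z (w s)) with hb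
  have hbc : Continuous b := by fun_prop
  have hb0 : ∀ z, 0 ≤ b z := fun z => le_max_left _ _
  have hbρ : ∀ z, b z ≤ ρ := fun z => max_le hρ0.le (by linarith [dist_nonneg (x := z) (y := w s)])
  have hbpos : ∀ z, 0 < b z → dist z (w s) < ρ := fun z hz => by
    by_contra! h
    exact hz.ne' (max_eq_left (by linarith))
  obtain ⟨y, hyK, hymax⟩ := hYK.exists_isMaxOn (f := fun x => b (w x) / x d) ⟨s, hsK⟩
    (ContinuousOn.div (by fun_prop) (by fun_prop) fun x hx => (hKd x hx).ne')
  have hyd := hKd y hyK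
  set M := b (w y) / y d with hM
  have hMs : ρ / s d ≤ M := by
    have := hymax hsK
    simpa [hb, hρ0.le] using this
  have hM0 : 0 < M := lt_of_lt_of_le (by positivity) hMs
  have hby : 0 < b (w y) := by
    rcases (hb0 (w y)).lt_or_eq with h | h
    · exact h
    · rw [hM, ← h, zero_div] at hM0
      exact absurd hM0 (lt_irrefl _)
  set β : EuclideanSpace ℝ (Fin n) → ℝ := fun z => b z / M / (1 + dist z (w y)) with hβ
  have hβ0 : ∀ z, 0 ≤ β z := fun z => by have := hb0 z; positivity
  have hβle : ∀ z, β z ≤ b z / M := fun z =>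
    div_le_self (div_nonneg (hb0 z) hM0.le) (by linarith [dist_nonneg (x := z) (y := w y)])
  have hβη : ∀ z, β z ≤ η / 2 := fun z => by
    refine (hβle z).trans ?_
    rw [div_le_iff₀ (hsd)] at hMs
    rw [div_le_iff₀ hM0]
    nlinarith [hbρ z]
  have hβc : Continuous β := by
    refine Continuous.div (by fun_prop) (by fun_prop) fun z => ?_
    positivity
  have hβy : β (w y) = y d := by
    simp only [hβ, dist_self, add_zero, div_one, hM]
    field_simp
  have hbK : ∀ x ∈ Y ∩ K, b (w x) / M ≤ x d := fun x hx => by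
    have := hymax hx
    rw [div_le_iff₀ hM0, mul_comm, ← div_le_iff₀ (hKd x hx)]
    exact this
  have hβuniq : ∀ x ∈ Y ∩ K, x d ≤ β (w x) → x = y := fun x hx hle => by
    have hxd := hKd x hx
    have h2 := hbK x hx
    have h0 : 0 < 1 + dist (w x) (w y) := by positivity
    have h3 : x d * (1 + dist (w x) (w y)) ≤ x d := by
      rw [hβ, le_div_iff₀ h0] at hle
      exact hle.trans h2
    have h4 : w x = w y := by
      by_contra hne
      nlinarith [mul_pos hxd (dist_pos.2 hne)]
    have h5 : x d = y d := le_antisymm (by rwa [h4, hβy] at hle) (by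
      rw [← hβy, ← h4]
      exact (hβle _).trans h2)
    have h6 : x - x d • v = y - y d • v := h4
    rw [h5] at h6
    exact sub_left_injective h6
  set χ : ℝ → ℝ := fun t => max 0 (min 1 (2 - |t| / η)) with hχ
  have hχ0 : ∀ t, 0 ≤ χ t := fun t => le_max_left _ _
  have hχ1 : ∀ t, χ t ≤ 1 := fun t => max_le zero_le_one (min_le_left _ _)
  have hχc : Continuous χ := by fun_prop
  have hχpos : ∀ t, χ t ≠ 0 → |t| ≤ 2 * η := fun t ht => by
    by_contra! h
    refine ht (max_eq_left ((min_le_right _ _).trans ?_))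
    rw [sub_nonpos, le_div_iff₀ hη0]
    exact h.le
  have hχlip : ∀ t u, |χ t - χ u| ≤ |t - u| / η := fun t u => by
    have h1 : |χ t - χ u| ≤ |min 1 (2 - |t| / η) - min 1 (2 - |u| / η)| :=
      abs_max_sub_max_le_max 0 _ 0 _ |>.trans (by simp)
    have h2 : |min 1 (2 - |t| / η) - min 1 (2 - |u| / η)| ≤ |(2 - |t| / η) - (2 - |u| / η)| :=
      abs_min_sub_min_le_max 1 _ 1 _ |>.trans (by simp)
    have h3 : |(2 - |t| / η) - (2 - |u| / η)| ≤ |t - u| / η := by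
      rw [show (2 - |t| / η) - (2 - |u| / η) = (|u| - |t|) / η by ring, abs_div, abs_of_pos hη0]
      rw [abs_sub_comm t u]
      exact div_le_div_of_nonneg_right (abs_abs_sub_abs_le _ _) hη0.le
    exact h1.trans (h2.trans h3)
  set φ : EuclideanSpace ℝ (Fin n) → ℝ := fun x => χ (x d) * β (w x) with hφ
  have hφ0 : ∀ x, 0 ≤ φ x := fun x => mul_nonneg (hχ0 _) (hβ0 _)
  have hφβ : ∀ x, φ x ≤ β (w x) := fun x => mul_le_of_le_one_left (hβ0 _) (hχ1 _)
  have hφK : ∀ x, φ x ≠ 0 → x ∈ K := fun x hx => by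
    refine ⟨hχpos _ (left_ne_zero_of_mul hx), (hbpos _ ?_).le⟩
    refine (hb0 _).lt_of_ne fun h => right_ne_zero_of_mul hx ?_
    simp [hβ, ← h]
  have hφy : φ y = y d := by
    have : y d ≤ η := by rw [← hβy]; linarith [hβη (w y)]
    have : y d / η ≤ 1 := (div_le_one hη0).2 this
    have : χ (y d) = 1 := by
      simp only [hχ, abs_of_pos hyd]
      rw [min_eq_left (by linarith), max_eq_right zero_le_one]
    simp only [hφ, this, hβy, one_mul]
  obtain ⟨h, hh⟩ := exists_homeomorph_sub_smul (φ := φ) (by fun_prop) v (c := 1 / 2)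
    (by rw [← NNReal.coe_lt_coe]; norm_num) fun x => LipschitzWith.of_dist_le_mul fun t u => by
      simp only [hφ, hwv, Real.dist_eq, ← sub_mul, abs_mul, abs_of_nonneg (hβ0 _)]
      have h1 := hχlip ((x + t • v) d) ((x + u • v) d)
      simp only [PiLp.add_apply, PiLp.smul_apply, hvd, smul_eq_mul, mul_one,
        add_sub_add_left_eq_sub] at h1 ⊢
      calc _ ≤ |t - u| / η * (η / 2) := mul_le_mul h1 (hβη _) (hβ0 _) (by positivity)
        _ = _ := by push_cast; field_simp
  have hhfix : ∀ x, φ x = 0 → h x = x := fun x hx => by rw [hh, hx, zero_smul, sub_zero]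
  have hhK : ∀ x ∈ K, h x ∈ ball p ε := fun x hx => by
    have h1 : dist (h x) x ≤ η / 2 * 2 := by
      rw [hh, dist_eq_norm, sub_sub_cancel_left, norm_neg, norm_smul, Real.norm_eq_abs,
        abs_of_nonneg (hφ0 x)]
      exact mul_le_mul ((hφβ x).trans (hβη _)) hv2 (norm_nonneg _) (by positivity)
    have h2 := dist_triangle (h x) x p
    have h3 := hKball x hx
    exact mem_ball.2 (by linarith)
  have hhd : ∀ x, (h x) d = x d - φ x := fun x => by
    simp [hh, hvd]
  have hYimg : ∀ x ∈ Y, h x ∈ unitCube n := fun x hx => by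
    by_cases h0 : φ x = 0
    · rw [hhfix x h0]
      exact hYI hx
    · have hxK := hφK x h0
      obtain ⟨-, h1, h2⟩ := hball (hhK x hxK)
      intro i
      by_cases hi : i = d
      · subst hi
        refine ⟨?_, h2.le⟩
        rw [hhd]
        linarith [hφβ x, hβle (w x), hbK x ⟨hx, hxK⟩]
      · exact Ioo_subset_Icc_self (h1 i hi)
  have hhy : h y = w y := by rw [hh, hφy]
  have hyd0 : (h y) d = 0 := by rw [hhd, hφy, sub_self]
  refine ⟨h, h y, fun x hx => hhfix x ?_, ?_, (hball (hhK y hyK.2)).1, fun hyp => ?_, hyd0, ?_⟩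
  · by_contra h0
    exact hx (interior_subset (hball (hKsub x (hφK x h0))).1)
  · rintro _ ⟨x, hx, rfl⟩
    exact hYimg x hx
  · have := hbpos _ hby
    rw [← hhy, hyp, dist_comm] at this
    linarith
  · ext z
    constructor
    · rintro ⟨⟨x, hx, rfl⟩, hz⟩
      by_cases h0 : φ x = 0
      · rw [hhfix x h0] at hz ⊢
        exact Or.inl ⟨hx, hz⟩
      · right
        have hxK := hφK x h0
        obtain ⟨-, h1, h2⟩ := hball (hhK x hxK)
        rw [mem_frontier_unitCube_iff (hYimg x hx)] at hz
        have h3 : (h x) d ≤ 0 := by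
          by_contra! h4
          refine hz fun i => ?_
          by_cases hi : i = d
          · subst hi
            exact ⟨h4, h2⟩
          · exact h1 i hi
        rw [hhd] at h3
        rw [hβuniq x ⟨hx, hxK⟩ (by linarith [hφβ x])]
        rfl
    · rintro (⟨hz, hzf⟩ | rfl)
      · have h0 : φ z = 0 := by
          by_contra h0
          have hzK := hφK z h0
          exact hpK (hbd z hz hzf (interior_subset (hball (hKsub z hzK)).1) ▸ hzK)
        exact ⟨⟨z, hz, hhfix z h0⟩, hzf⟩
      · refine ⟨⟨y, hyK.1, rfl⟩, ?_⟩
        rw [mem_frontier_unitCube_iff (hYimg y hyK.1)]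
        exact fun h1 => (h1 d).1.ne' hyd0

/-- **Statement 5.3 (Frolkina, "feelers").** If a non-empty perfect compact `X ⊆ Iⁿ` meets
`∂Iⁿ` in finitely many points `p₁, …, p_k` of `(0,1)^{n-1} × {0}`, and `N_i` are disjoint
`n`-cube neighborhoods of the `p_i` with `π(N_i) ⊆ [0,1]^{n-1}`, then a self-homeomorphism
of `ℝⁿ`, supported in `⋃ N_i`, keeps `X` in `Iⁿ` and doubles each boundary point `p_i`
by a new point `q_i ∈ π(int N_i) × {0}`. -/
theorem feelers (n : ℕ) (hn : 2 ≤ n) (X : Set (EuclideanSpace ℝ (Fin n)))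
    (hne : X.Nonempty) (hperf : Perfect X) (hcpt : IsCompact X) (hXI : X ⊆ unitCube n)
    (k : ℕ) (p : Fin k → EuclideanSpace ℝ (Fin n)) (hpinj : Function.Injective p)
    (hpface : ∀ i, p i ∈ openFace n)
    (hbd : X ∩ frontier (unitCube n) = Set.range p)
    (N : Fin k → Set (EuclideanSpace ℝ (Fin n))) (hN : ∀ i, IsCubeNbhd (N i) (p i))
    (hNproj : ∀ i, ∀ x ∈ N i, ∀ j : Fin n, (j : ℕ) < n - 1 → x j ∈ Set.Icc (0 : ℝ) 1)
    (hNdisj : ∀ i j, i ≠ j → Disjoint (N i) (N j)) :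
    ∃ h : EuclideanSpace ℝ (Fin n) ≃ₜ EuclideanSpace ℝ (Fin n),
      (∀ x ∉ ⋃ i, N i, h x = x) ∧
      h '' X ⊆ unitCube n ∧
      ∃ q : Fin k → EuclideanSpace ℝ (Fin n),
        (∀ i, q i ≠ p i ∧
          (∀ j : Fin n, (j : ℕ) = n - 1 → q i j = 0) ∧
          ∃ y ∈ interior (N i), ∀ j : Fin n, (j : ℕ) < n - 1 → q i j = y j) ∧
        h '' X ∩ frontier (unitCube n) = Set.range p ∪ Set.range q := by
  have hd : n - 1 < n := by omega
  set d : Fin n := ⟨n - 1, hd⟩ with hd_def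
  have hed : (⟨0, by omega⟩ : Fin n) ≠ d := fun h => by
    have := congrArg Fin.val h
    simp only [hd_def] at this
    omega
  have hpX : ∀ i, p i ∈ X := fun i => (hbd.symm.subset (mem_range_self i)).1
  have hpN : ∀ i, p i ∈ N i := fun i => interior_subset (hN i).2
  have main : ∀ S : Finset (Fin k),
      ∃ h : EuclideanSpace ℝ (Fin n) ≃ₜ EuclideanSpace ℝ (Fin n),
        (∀ x, (∀ i ∈ S, x ∉ N i) → h x = x) ∧ h '' X ⊆ unitCube n ∧
        ∃ q : Fin k → EuclideanSpace ℝ (Fin n),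
          (∀ i ∈ S, q i ≠ p i ∧ q i d = 0 ∧ q i ∈ interior (N i)) ∧
          h '' X ∩ frontier (unitCube n) = Set.range p ∪ q '' S := by
    intro S
    induction S using Finset.induction_on with
    | empty => exact ⟨Homeomorph.refl _, by simp, by simpa using hXI, p, by simp, by simpa using hbd⟩
    | insert j S hj ih =>
      obtain ⟨h, hfix, hI, q, hq, hfr⟩ := ih
      have hne_of_mem : ∀ i ∈ S, i ≠ j := fun i hi hij => hj (hij ▸ hi)
      have hpj : h (p j) = p j := hfix _ fun i hi hpi =>
        (hNdisj i j (hne_of_mem i hi)).notMem_of_mem_left hpi (hpN j)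
      have hacc : AccPt (p j) (Filter.principal (h '' X)) := by
        rw [accPt_iff_nhds]
        intro U hU
        have hU' : h ⁻¹' U ∈ 𝓝 (p j) := h.continuous.continuousAt.preimage_mem_nhds (by rwa [hpj])
        obtain ⟨x, ⟨hxU, hxX⟩, hxp⟩ := accPt_iff_nhds.1 (hperf.acc _ (hpX j)) _ hU'
        exact ⟨h x, ⟨hxU, x, hxX, rfl⟩, fun hx => hxp (h.injective (hx.trans hpj.symm))⟩
      obtain ⟨g, r, hgfix, hgI, hrN, hrp, hrd, hgfr⟩ := exists_feeler (N := N j) (d := d) rfl hed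
        (hcpt.image h.continuous) hI (hpface j) hacc (mem_interior_iff_mem_nhds.1 (hN j).2) (by
          intro y hy hyf hyN
          rcases hfr.subset ⟨hy, hyf⟩ with ⟨i, rfl⟩ | ⟨i, hi, rfl⟩
          · by_contra hij
            exact (hNdisj i j fun h => hij (h ▸ rfl)).notMem_of_mem_left (hpN i) hyN
          · exact ((hNdisj i j (hne_of_mem i hi)).notMem_of_mem_left
              (interior_subset (hq i hi).2.2) hyN).elim)
      have hcomp : (h.trans g) '' X = g '' (h '' X) := by
        rw [Set.image_image]
        rfl
      refine ⟨h.trans g, fun x hx => ?_, hcomp ▸ hgI, Function.update q j r, fun i hi => ?_, ?_⟩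
      · rw [Homeomorph.trans_apply, hfix x fun i hi => hx i (Finset.mem_insert_of_mem hi),
          hgfix x (hx j (Finset.mem_insert_self j S))]
      · rcases Finset.mem_insert.1 hi with rfl | hi
        · simpa using ⟨hrp, hrd, hrN⟩
        · rw [Function.update_of_ne (hne_of_mem i hi)]
          exact hq i hi
      · have himg : Function.update q j r '' S = q '' S :=
          Set.image_congr fun i hi => Function.update_of_ne (hne_of_mem i hi) _ _
        rw [hcomp, hgfr, hfr, Finset.coe_insert, Set.image_insert_eq, himg,
          Function.update_self, Set.union_assoc, Set.union_singleton]
  obtain ⟨h, hfix, hI, q, hq, hfr⟩ := main Finset.univ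
  refine ⟨h, fun x hx => hfix x fun i _ hi => hx (mem_iUnion_of_mem i hi), hI, q, fun i => ?_, ?_⟩
  · obtain ⟨h1, h2, h3⟩ := hq i (Finset.mem_univ i)
    refine ⟨h1, fun j hj => ?_, q i, h3, fun _ _ => rfl⟩
    rwa [show j = d from Fin.ext hj]
  · simpa using hfr

end
end

section
/- Let X ⊆ ℝⁿ be a non-empty perfect compact set, n ≥ 2. Then there exists a homeomorphism h of ℝⁿ onto itself such that: h(X) ⊆ Iⁿ; h(X) ∩ ∂Iⁿ ⊆ (0,1)^{n−1} × {0}; and h(X) ∩ ∂Iⁿ is a Cantor set which is cellularly separated as a subset of the (n−1)-manifold (0,1)^{n−1} × {0}. -/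
open Set Topology Metric

noncomputable section

/-- A set `K` in a topological `m`-manifold `M` is cellularly separated if every open
neighborhood `V` of `K` contains a family of open sets `u_α` covering `K`, with
`u_α ≃ₜ ℝᵐ`, `closure (u_α) ≃ₜ Iᵐ`, the closures pairwise disjoint and contained in `V`. -/
def IsCellularlySeparated (m : ℕ) {M : Type} [TopologicalSpace M] (K : Set M) : Prop :=
  ∀ V : Set M, IsOpen V → K ⊆ V →
    ∃ (ι : Type) (u : ι → Set M),
      (∀ α, IsOpen (u α)) ∧
      K ⊆ (⋃ α, u α) ∧
      (⋃ α, closure (u α)) ⊆ V ∧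
      (∀ α, Nonempty (↥(u α) ≃ₜ EuclideanSpace ℝ (Fin m))) ∧
      (∀ α, Nonempty (↥(closure (u α)) ≃ₜ ↥(unitCube m))) ∧
      (∀ α β, α ≠ β → Disjoint (closure (u α)) (closure (u β)))

theorem not_countable_of_nat_bool_injection {α : Type*} {A : Set α} {f : (ℕ → Bool) → α}
    (hf : Function.Injective f) (hfA : range f ⊆ A) : ¬ A.Countable := fun hA => by
  have hbool : Uncountable (ℕ → Bool) := by
    rw [← Cardinal.aleph0_lt_mk_iff]
    simpa using Cardinal.aleph0_lt_continuum
  exact not_countable_univ (MapsTo.countable_of_injOn (s := univ)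
    (fun c _ => hfA (mem_range_self c)) hf.injOn hA)

/-- A measurable real function on an uncountable Polish space is continuous along some injected
Cantor space. -/
theorem exists_continuous_injection_comp_continuous {P : Type*} [TopologicalSpace P] [PolishSpace P]
    [MeasurableSpace P] [BorelSpace P] (hP : Uncountable P) {g : P → ℝ} (hg : Measurable g) :
    ∃ ι : (ℕ → Bool) → P, Continuous ι ∧ Function.Injective ι ∧ Continuous (g ∘ ι) := by
  obtain ⟨t', ht', hgt', hpol⟩ := hg.exists_continuous
  have huniv : ¬ (univ : Set P).Countable := fun h => by
    have := countable_univ_iff.1 h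
    exact not_countable (α := P) this
  obtain ⟨ι, -, hι, hinj⟩ :=
    @IsClosed.exists_nat_bool_injection_of_not_countable P t' hpol univ
      (@isClosed_univ P t') huniv
  refine ⟨ι, ?_, hinj, ?_⟩
  · exact continuous_le_rng ht' hι
  · exact @Continuous.comp _ _ _ _ t' _ _ _ hgt' hι

/-- Over an uncountable part of the values of `p`, the `q`-minimal points of the fibres of `p`
in a compact set can be selected to form a compact set. -/
theorem IsCompact.exists_fiberwise_min {α : Type*} [TopologicalSpace α] [T2Space α] {Y : Set α}
    (hY : IsCompact Y) {p q : α → ℝ} (hp : Continuous p) (hq : Continuous q)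
    (hunc : ¬ (p '' Y).Countable) :
    ∃ Y' ⊆ Y, IsCompact Y' ∧ ¬ (p '' Y').Countable ∧
      ∀ x ∈ Y', ∀ y ∈ Y, p x = p y → q x ≤ q y := by
  have hPc : IsCompact (p '' Y) := hY.image hp
  have : PolishSpace ↥(p '' Y) := hPc.isClosed.polishSpace
  have hfib : ∀ a : ℝ, IsCompact (Y ∩ p ⁻¹' {a}) := fun a =>
    hY.inter_right (isClosed_singleton.preimage hp)
  have hmin : ∀ a : ↥(p '' Y), ∃ x ∈ Y ∩ p ⁻¹' {a.1}, ∀ y ∈ Y ∩ p ⁻¹' {a.1}, q x ≤ q y := by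
    rintro ⟨_, x, hx, rfl⟩
    exact (hfib (p x)).exists_isMinOn ⟨x, hx, rfl⟩ hq.continuousOn
  choose s hs hsmin using hmin
  have hg : Measurable (fun a => q (s a)) := by
    refine measurable_of_Iic fun c => ?_
    have : (fun a => q (s a)) ⁻¹' Iic c = Subtype.val ⁻¹' (p '' (Y ∩ q ⁻¹' Iic c)) := by
      ext a
      constructor
      · intro h
        exact ⟨s a, ⟨(hs a).1, h⟩, (hs a).2⟩
      · rintro ⟨x, ⟨hx, hxc⟩, hxa⟩
        exact (hsmin a x ⟨hx, hxa⟩).trans hxc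
    rw [this]
    exact (((hY.inter_right (isClosed_Iic.preimage hq)).image hp).isClosed.preimage
      continuous_subtype_val).measurableSet
  have hunc' : Uncountable ↥(p '' Y) := by
    rw [← not_countable_iff]
    exact fun h => hunc h.to_set
  obtain ⟨ι, hι, hinj, hgι⟩ := exists_continuous_injection_comp_continuous hunc' hg
  let Z : Set (α × (ℕ → Bool)) := (Y ×ˢ univ) ∩ {z | p z.1 = (ι z.2 : ℝ) ∧ q z.1 = q (s (ι z.2))}
  have hZ : IsCompact Z := by
    refine (hY.prod isCompact_univ).inter_right ?_
    refine (isClosed_eq (by fun_prop) (by fun_prop)).inter (isClosed_eq (by fun_prop) ?_)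
    exact hgι.comp continuous_snd
  refine ⟨Prod.fst '' Z, ?_, hZ.image continuous_fst, ?_, ?_⟩
  · rintro _ ⟨z, hz, rfl⟩
    exact hz.1.1
  · have hsub : range (fun c => (ι c : ℝ)) ⊆ p '' (Prod.fst '' Z) := by
      rintro _ ⟨c, rfl⟩
      exact ⟨s (ι c), ⟨(s (ι c), c), ⟨⟨(hs _).1, mem_univ _⟩, (hs _).2, rfl⟩, rfl⟩, (hs _).2⟩
    exact not_countable_of_nat_bool_injection (Subtype.val_injective.comp hinj) hsub
  · rintro _ ⟨⟨x, c⟩, ⟨-, hpx, hqx⟩, rfl⟩ y hy hxy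
    simp only at hpx hqx hxy ⊢
    rw [hqx]
    exact hsmin _ y ⟨hy, by simp [← hxy, hpx]⟩

/-- Over an uncountable part of the values of `p`, finitely many functions become constant on the
fibres of `p` after shrinking the compact set. -/
theorem IsCompact.exists_fiberwise_const {α : Type*} [TopologicalSpace α] [T2Space α] {Y : Set α}
    (hY : IsCompact Y) {p : α → ℝ} (hp : Continuous p) {ι : Type*} {q : ι → α → ℝ}
    (hq : ∀ i, Continuous (q i)) (hunc : ¬ (p '' Y).Countable) (F : Finset ι) :
    ∃ Y' ⊆ Y, IsCompact Y' ∧ ¬ (p '' Y').Countable ∧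
      ∀ i ∈ F, ∀ x ∈ Y', ∀ y ∈ Y', p x = p y → q i x = q i y := by
  classical
  induction F using Finset.induction_on with
  | empty => exact ⟨Y, Subset.rfl, hY, hunc, by simp⟩
  | insert i F _ ih =>
    obtain ⟨Y₁, hsub₁, hY₁, hunc₁, h₁⟩ := ih
    obtain ⟨Y₂, hsub₂, hY₂, hunc₂, h₂⟩ := hY₁.exists_fiberwise_min hp (hq i) hunc₁
    refine ⟨Y₂, hsub₂.trans hsub₁, hY₂, hunc₂, fun j hj x hx y hy hxy => ?_⟩
    rcases Finset.mem_insert.1 hj with rfl | hj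
    · exact (h₂ x hx y (hsub₂ hy) hxy).antisymm (h₂ y hy x (hsub₂ hx) hxy.symm)
    · exact h₁ j hj x (hsub₂ hx) y (hsub₂ hy) hxy

/-- A compact set on which `p` is injective with uncountable image contains a Cantor space
embedded by `p`. -/
theorem IsCompact.exists_nat_bool_comp_injective {α : Type*} [TopologicalSpace α] {K : Set α}
    (hK : IsCompact K) {p : α → ℝ} (hp : Continuous p) (hinj : InjOn p K)
    (hunc : ¬ (p '' K).Countable) :
    ∃ κ : (ℕ → Bool) → α, Continuous κ ∧ Function.Injective (p ∘ κ) ∧ ∀ c, κ c ∈ K := by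
  obtain ⟨ι, hιK, hι, hιinj⟩ :=
    (hK.image hp).isClosed.exists_nat_bool_injection_of_not_countable hunc
  choose κ hκK hκ using fun c => hιK (mem_range_self c)
  have : CompactSpace K := isCompact_iff_compactSpace.1 hK
  have hemb : IsClosedEmbedding (fun x : K => p x) :=
    Continuous.isClosedEmbedding (by fun_prop) hinj.injective
  let κ' : (ℕ → Bool) → K := fun c => ⟨κ c, hκK c⟩
  have hκ' : Continuous κ' := by
    rw [hemb.isEmbedding.continuous_iff]
    convert hι using 1
    exact funext hκ
  refine ⟨κ, continuous_subtype_val.comp hκ', ?_, hκK⟩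
  convert hιinj using 1
  exact funext hκ

/-- On a compact space, a nonnegative function `e` vanishing on the zero set of `δ ≥ 0` is
dominated by a continuous function of `δ` vanishing at `0`. -/
theorem exists_continuous_modulus_s13 {Y : Type*} [TopologicalSpace Y] [CompactSpace Y] {e δ : Y → ℝ}
    (he : Continuous e) (hδ : Continuous δ) (he0 : ∀ y, 0 ≤ e y) (hδ0 : ∀ y, 0 ≤ δ y)
    (h : ∀ y, δ y = 0 → e y = 0) :
    ∃ ω : ℝ → ℝ, Continuous ω ∧ ω 0 = 0 ∧ ∀ y, e y ≤ ω (δ y) := by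
  let f : ℝ → Y → ℝ := fun r y => e y * (|r| / max |r| (δ y))
  have hbd : ∀ r y, |r| / max |r| (δ y) ≤ 1 := fun r y =>
    div_le_one_of_le₀ (le_max_left _ _) ((abs_nonneg r).trans (le_max_left _ _))
  have hnn : ∀ r y, 0 ≤ |r| / max |r| (δ y) := fun r y =>
    div_nonneg (abs_nonneg r) ((abs_nonneg r).trans (le_max_left _ _))
  have hf : Continuous ↿f := by
    rw [continuous_iff_continuousAt]
    rintro ⟨r, y⟩
    by_cases h0 : max |r| (δ y) = 0
    · have hy : e y = 0 := h y (le_antisymm (h0 ▸ le_max_right _ _) (hδ0 y))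
      have hfy : (↿f) (r, y) = 0 := by
        change e y * _ = 0
        rw [hy, zero_mul]
      rw [ContinuousAt, hfy]
      have hlim : Filter.Tendsto (fun z : ℝ × Y => e z.2) (𝓝 (r, y)) (𝓝 0) := by
        have : Continuous (fun z : ℝ × Y => e z.2) := by fun_prop
        simpa [hy] using this.tendsto (r, y)
      refine squeeze_zero (fun z => mul_nonneg (he0 _) (hnn _ _)) (fun z => ?_) hlim
      exact mul_le_of_le_one_right (he0 _) (hbd _ _)
    · have h1 : ContinuousAt (fun z : ℝ × Y => |z.1| / max |z.1| (δ z.2)) (r, y) :=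
        ContinuousAt.div (by fun_prop) (by fun_prop) h0
      exact (he.comp continuous_snd).continuousAt.mul h1
  refine ⟨fun r => sSup (f r '' univ), isCompact_univ.continuous_sSup hf, ?_, fun y => ?_⟩
  · have : f 0 = fun _ => 0 := by
      ext y
      simp [f]
    simp only [this]
    rcases isEmpty_or_nonempty Y with hY | hY
    · simp [range_eq_empty]
    · simp
  · have hval : f (δ y) y = e y := by
      by_cases hy : δ y = 0
      · simp [f, hy, h y hy]
      · simp [f, abs_of_nonneg (hδ0 y), div_self hy]
    have hbdd : BddAbove (f (δ y) '' univ) :=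
      (isCompact_univ.image (by fun_prop : Continuous (f (δ y)))).bddAbove
    rw [← hval]
    exact le_csSup hbdd ⟨y, mem_univ y, rfl⟩

/-- A continuous function supporting a compact set from below exactly along the image of `κ`. -/
theorem exists_continuous_support_from_below {F : Type*} [MetricSpace F] {Z : Set (F × ℝ)}
    (hZ : IsCompact Z) {κ : (ℕ → Bool) → F × ℝ} (hκ : Continuous κ)
    (hinj : Function.Injective fun c => (κ c).1)
    (hmin : ∀ c, ∀ z ∈ Z, (κ c).1 = z.1 → (κ c).2 ≤ z.2) :
    ∃ f : F → ℝ, Continuous f ∧ (∀ c, f (κ c).1 = (κ c).2) ∧ (∀ z ∈ Z, f z.1 ≤ z.2) ∧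
      ∀ z ∈ Z, f z.1 = z.2 → z ∈ range κ := by
  have hemb : IsClosedEmbedding (fun c => (κ c).1) :=
    Continuous.isClosedEmbedding (by fun_prop) hinj
  obtain ⟨u, hu⟩ := ContinuousMap.exists_extension' hemb ⟨fun c => (κ c).2, by fun_prop⟩
  replace hu : ∀ c, u (κ c).1 = (κ c).2 := fun c => congrFun hu c
  set D := range (fun c => (κ c).1) with hD
  have hDne : D.Nonempty := range_nonempty _
  have hDz : ∀ x, infDist x D = 0 ↔ x ∈ D := fun x =>
    (hemb.isClosed_range.mem_iff_infDist_zero hDne).symm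
  have : CompactSpace Z := isCompact_iff_compactSpace.1 hZ
  obtain ⟨ω, hω, hω0, hωe⟩ := exists_continuous_modulus_s13 (Y := Z)
    (e := fun z => max (u z.1.1 - z.1.2) 0) (δ := fun z => infDist z.1.1 D)
    (by fun_prop) (by fun_prop) (fun _ => le_max_right _ _) (fun _ => infDist_nonneg) (by
      rintro ⟨z, hz⟩ h
      obtain ⟨c, hc⟩ := (hDz _).1 h
      simp only at hc
      have := hmin c z hz hc
      simp [← hc, hu, this])
  have key : ∀ z ∈ Z, u z.1 - ω (infDist z.1 D) ≤ z.2 := fun z hz => by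
    have := (le_max_left _ _).trans (hωe ⟨z, hz⟩)
    simp only at this
    linarith
  refine ⟨fun x => u x - ω (infDist x D) - infDist x D, by fun_prop, fun c => ?_,
    fun z hz => ?_, fun z hz h => ?_⟩
  · have : infDist (κ c).1 D = 0 := (hDz _).2 ⟨c, rfl⟩
    simp [this, hω0, hu]
  · have := key z hz
    have := infDist_nonneg (x := z.1) (s := D)
    dsimp only
    linarith
  · have h1 := key z hz
    have h2 := infDist_nonneg (x := z.1) (s := D)
    have h3 : infDist z.1 D = 0 := by
      dsimp only at h
      linarith
    obtain ⟨c, hc⟩ := (hDz _).1 h3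
    simp only at hc
    refine ⟨c, Prod.ext hc ?_⟩
    rw [← h]
    simp only [h3, hω0, sub_zero]
    rw [← hc, hu]

/-- The inverse of a continuous injection of a compact set into the line is uniformly continuous. -/
theorem IsCompact.exists_dist_lt_of_injOn {F : Type*} [MetricSpace F] {S : Set F}
    (hS : IsCompact S) {p : F → ℝ} (hp : Continuous p) (hinj : InjOn p S) {ε : ℝ} (hε : 0 < ε) :
    ∃ η > 0, ∀ x ∈ S, ∀ y ∈ S, |p x - p y| < η → dist x y < ε := by
  have hT : IsCompact ((S ×ˢ S) ∩ {z | ε ≤ dist z.1 z.2}) :=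
    (hS.prod hS).inter_right (isClosed_le (by fun_prop) (by fun_prop))
  rcases ((S ×ˢ S) ∩ {z | ε ≤ dist z.1 z.2}).eq_empty_or_nonempty with h | h
  · refine ⟨1, one_pos, fun x hx y hy _ => lt_of_not_ge fun hxy => ?_⟩
    exact eq_empty_iff_forall_notMem.1 h (x, y) ⟨⟨hx, hy⟩, hxy⟩
  · obtain ⟨⟨a, b⟩, ⟨⟨ha, hb⟩, hab⟩, hmin⟩ := hT.exists_isMinOn h
      (f := fun z => |p z.1 - p z.2|) (by fun_prop)
    refine ⟨|p a - p b|, ?_, fun x hx y hy hxy => lt_of_not_ge fun h => ?_⟩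
    · rw [gt_iff_lt, abs_pos, sub_ne_zero]
      intro h
      have hab' : a = b := hinj ha hb h
      have hle : ε ≤ dist a b := hab
      rw [hab', dist_self] at hle
      linarith
    · exact absurd (isMinOn_iff.1 hmin (x, y) ⟨⟨hx, hy⟩, h⟩) (not_le.2 hxy)

/-- A closed subset of the line with dense complement is covered by arbitrarily short open
intervals, indexed by `ℤ`, with disjoint closures. -/
theorem IsClosed.exists_separating_intervals {A : Set ℝ} (hA : IsClosed A)
    (hd : Dense Aᶜ) {η : ℝ} (hη : 0 < η) :
    ∃ l r : ℤ → ℝ, (∀ i, r i - l i < η) ∧ (∀ a ∈ A, ∃ i, a ∈ Ioo (l i) (r i)) ∧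
      ∀ i j, i < j → r i < l j := by
  have hw : 0 < η / 2 := by positivity
  set w := η / 2 with hw'
  have hgap : ∀ i : ℤ, ∃ c d : ℝ, c < d ∧ i * w < c ∧ d < (i + 1) * w ∧ Icc c d ⊆ Aᶜ := fun i => by
    have hne : (Ioo (i * w) ((i + 1) * w) : Set ℝ).Nonempty := nonempty_Ioo.2 (by nlinarith)
    obtain ⟨c, hc, hcA⟩ := hd.inter_open_nonempty _ isOpen_Ioo hne
    obtain ⟨r, hr, hball⟩ := Metric.isOpen_iff.1 (isOpen_Ioo.inter hA.isOpen_compl) c ⟨hc, hcA⟩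
    have hIcc : Icc c (c + r / 2) ⊆ ball c r := fun x hx => by
      rw [mem_ball, Real.dist_eq, abs_lt]
      constructor <;> linarith [hx.1, hx.2]
    have hmem := (hball (hIcc ⟨by linarith, le_rfl⟩)).1
    exact ⟨c, c + r / 2, by linarith, hc.1, hmem.2, fun x hx => (hball (hIcc hx)).2⟩
  choose c d hcd hc hd' hA' using hgap
  have hsucc : ∀ i : ℤ, d i < c (i + 1) := fun i => by
    have := hc (i + 1)
    push_cast at this
    exact (hd' i).trans this
  have hmono : StrictMono d := strictMono_int_of_lt_succ fun i => (hsucc i).trans (hcd _)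
  refine ⟨d, fun i => c (i + 1), fun i => ?_, fun a ha => ?_, fun i j hij => ?_⟩
  · have h1 := hd' (i + 1)
    have h2 := hcd (i + 1)
    have h3 := hc i
    have h4 := hcd i
    push_cast at h1
    nlinarith
  · have h1 : (⌊a / w⌋ : ℝ) * w ≤ a := (le_div_iff₀ hw).1 (Int.floor_le _)
    have h2 : a < (⌊a / w⌋ + 1 : ℝ) * w := (div_lt_iff₀ hw).1 (Int.lt_floor_add_one _)
    by_cases h : a < c ⌊a / w⌋
    · refine ⟨⌊a / w⌋ - 1, ?_, by simpa using h⟩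
      have := hd' (⌊a / w⌋ - 1)
      push_cast at this
      linarith
    · refine ⟨⌊a / w⌋, lt_of_not_ge fun h' => hA' _ ⟨not_lt.1 h, h'⟩ ha, ?_⟩
      have := hc (⌊a / w⌋ + 1)
      push_cast at this
      linarith
  · exact (hcd _).trans_le (hmono.monotone (by omega))

/-- A compact set embedded by a linear functional onto a set with dense complement has
arbitrarily small neighbourhoods made of bounded convex open sets with disjoint closures. -/
theorem IsCompact.exists_separating_convex {F : Type*} [NormedAddCommGroup F] [NormedSpace ℝ F]
    {S V : Set F} (hS : IsCompact S) {p : F →L[ℝ] ℝ} (hinj : InjOn p S) (hd : Dense (p '' S)ᶜ)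
    (hV : IsOpen V) (hSV : S ⊆ V) :
    ∃ (ι : Type) (B : ι → Set F), (∀ i, IsOpen (B i) ∧ (B i).Nonempty ∧ Convex ℝ (B i) ∧
      Bornology.IsBounded (B i) ∧ closure (B i) ⊆ V) ∧ S ⊆ ⋃ i, B i ∧
      ∀ i j, i ≠ j → Disjoint (closure (B i)) (closure (B j)) := by
  obtain ⟨ε, hε, hεV⟩ := hS.exists_cthickening_subset_open hV hSV
  obtain ⟨η, hη, hηS⟩ := hS.exists_dist_lt_of_injOn p.continuous hinj hε
  obtain ⟨l, r, hlen, hcov, hsep⟩ :=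
    (hS.image p.continuous).isClosed.exists_separating_intervals hd hη
  let ι : Type := {i : ℤ // ∃ z ∈ S, p z ∈ Ioo (l i) (r i)}
  choose z hzS hz using fun i : ι => i.2
  have hcl : ∀ i : ι, closure (p ⁻¹' Ioo (l i.1) (r i.1) ∩ ball (z i) ε) ⊆
      p ⁻¹' Icc (l i.1) (r i.1) ∩ closedBall (z i) ε := fun i =>
    closure_minimal (inter_subset_inter (preimage_mono Ioo_subset_Icc_self) ball_subset_closedBall)
      ((isClosed_Icc.preimage p.continuous).inter isClosed_closedBall)
  refine ⟨ι, fun i => p ⁻¹' Ioo (l i.1) (r i.1) ∩ ball (z i) ε, fun i => ⟨?_, ?_, ?_, ?_, ?_⟩,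
    fun x hx => ?_, fun i j hij => ?_⟩
  · exact (isOpen_Ioo.preimage p.continuous).inter isOpen_ball
  · exact ⟨z i, hz i, mem_ball_self hε⟩
  · exact ((convex_Ioo _ _).linear_preimage p.toLinearMap).inter (convex_ball _ _)
  · exact isBounded_ball.subset inter_subset_right
  · exact (hcl i).trans (inter_subset_right.trans
      ((closedBall_subset_cthickening (hzS i) ε).trans hεV))
  · obtain ⟨i, hi⟩ := hcov (p x) ⟨x, hx, rfl⟩
    let i' : ι := ⟨i, x, hx, hi⟩
    refine mem_iUnion.2 ⟨i', hi, hηS x hx _ (hzS i') ?_⟩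
    have h1 := hz i'
    have h2 := hlen i
    change p (z i') ∈ Ioo (l i) (r i) at h1
    rw [abs_lt]
    constructor <;> linarith [hi.1, hi.2, h1.1, h1.2]
  · refine Disjoint.mono (hcl i) (hcl j) (disjoint_left.2 fun x hxi hxj => ?_)
    have h1 := hxi.1
    have h2 := hxj.1
    simp only [mem_preimage, mem_Icc] at h1 h2
    rcases lt_or_gt_of_ne (fun h => hij (Subtype.ext h) : i.1 ≠ j.1) with h | h
    · linarith [hsep _ _ h]
    · linarith [hsep _ _ h]

theorem unitCube_eq_preimage (n : ℕ) :
    unitCube n = EuclideanSpace.equiv (Fin n) ℝ ⁻¹' (univ.pi fun _ => Icc (0 : ℝ) 1) := by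
  ext x
  exact (mem_univ_pi (t := fun _ : Fin n => Icc (0 : ℝ) 1) (f := fun i => x i)).symm

theorem convex_unitCube (n : ℕ) : Convex ℝ (unitCube n) := by
  rw [unitCube_eq_preimage]
  exact (convex_pi fun _ _ => convex_Icc 0 1).linear_preimage
    (EuclideanSpace.equiv (Fin n) ℝ).toLinearEquiv.toLinearMap

theorem isBounded_unitCube (n : ℕ) : Bornology.IsBounded (unitCube n) := by
  rw [unitCube_eq_preimage]
  exact (((isCompact_univ_pi fun _ => isCompact_Icc).image
    (EuclideanSpace.equiv (Fin n) ℝ).symm.continuous).isBounded).subset fun x hx =>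
    ⟨_, hx, by simp⟩

theorem interior_unitCube_nonempty (n : ℕ) : (interior (unitCube n)).Nonempty := by
  rw [interior_unitCube]
  exact ⟨WithLp.toLp 2 fun _ => 1 / 2, fun i => by norm_num⟩

theorem nonempty_homeomorph_of_convex {F : Type*} [NormedAddCommGroup F]
    [InnerProductSpace ℝ F] {B : Set F} (ho : IsOpen B) (hne : B.Nonempty)
    (hc : Convex ℝ B) (hb : Bornology.IsBounded B) : Nonempty (B ≃ₜ F) := by
  obtain ⟨h, hint, -, -⟩ := exists_homeomorph_image_interior_closure_frontier_eq_unitBall hc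
    (by rwa [ho.interior_eq]) hb
  rw [ho.interior_eq] at hint
  exact ⟨(h.image B).trans ((Homeomorph.setCongr hint).trans Homeomorph.unitBall.symm)⟩

theorem nonempty_closure_homeomorph_unitCube {n : ℕ} {B : Set (EuclideanSpace ℝ (Fin n))}
    (ho : IsOpen B) (hne : B.Nonempty) (hc : Convex ℝ B) (hb : Bornology.IsBounded B) :
    Nonempty (closure B ≃ₜ unitCube n) := by
  obtain ⟨h, -, hcl, -⟩ := exists_homeomorph_image_interior_closure_frontier_eq_unitBall hc
    (by rwa [ho.interior_eq]) hb
  obtain ⟨h', -, hcl', -⟩ := exists_homeomorph_image_interior_closure_frontier_eq_unitBall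
    (convex_unitCube n) (interior_unitCube_nonempty n) (isBounded_unitCube n)
  rw [(isClosed_unitCube n).closure_eq] at hcl'
  exact ⟨(h.image _).trans ((Homeomorph.setCongr (hcl.trans hcl'.symm)).trans (h'.image _).symm)⟩

/-- Splitting off the last coordinate of `ℝᵐ⁺¹`. -/
def lastCoordHomeomorph (m : ℕ) :
    EuclideanSpace ℝ (Fin (m + 1)) ≃ₜ EuclideanSpace ℝ (Fin m) × ℝ where
  toFun x := (WithLp.toLp 2 fun i => x i.castSucc, x (Fin.last m))
  invFun z := WithLp.toLp 2 (Fin.snoc (α := fun _ => ℝ) (fun i => z.1 i) z.2)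
  left_inv x := by
    ext i
    refine Fin.lastCases ?_ (fun i => ?_) i <;> simp
  right_inv z := by
    refine Prod.ext ?_ ?_
    · ext i
      simp
    · simp
  continuous_toFun := by fun_prop
  continuous_invFun := by
    refine (PiLp.continuous_toLp 2 _).comp (continuous_pi fun i => ?_)
    refine Fin.lastCases ?_ (fun i => ?_) i
    · simpa using continuous_snd
    · simp only [Fin.snoc_castSucc]
      fun_prop

theorem lastCoordHomeomorph_fst {m : ℕ} (x : EuclideanSpace ℝ (Fin (m + 1))) (i : Fin m) :
    (lastCoordHomeomorph m x).1 i = x i.castSucc := rfl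

theorem lastCoordHomeomorph_snd {m : ℕ} (x : EuclideanSpace ℝ (Fin (m + 1))) :
    (lastCoordHomeomorph m x).2 = x (Fin.last m) := rfl

/-- The vertical shear along the graph of a continuous function. -/
def verticalShear {F : Type*} [TopologicalSpace F] (f : F → ℝ) (hf : Continuous f) :
    F × ℝ ≃ₜ F × ℝ where
  toFun z := (z.1, z.2 - f z.1)
  invFun z := (z.1, z.2 + f z.1)
  left_inv z := by simp
  right_inv z := by simp
  continuous_toFun := by fun_prop
  continuous_invFun := by fun_prop

/-- Scaling by `c ≠ 0` followed by a horizontal translation. -/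
def scaleTranslate {F : Type*} [NormedAddCommGroup F] [NormedSpace ℝ F] (c : ℝ) (hc : c ≠ 0)
    (v : F) : F × ℝ ≃ₜ F × ℝ :=
  (Homeomorph.smulOfNeZero c hc).trans (Homeomorph.addRight (v, 0))

theorem scaleTranslate_apply {F : Type*} [NormedAddCommGroup F] [NormedSpace ℝ F] (c : ℝ)
    (hc : c ≠ 0) (v : F) (z : F × ℝ) :
    scaleTranslate c hc v z = (c • z.1 + v, c * z.2) := by
  simp [scaleTranslate, Prod.ext_iff]

/-- A compact set can be moved into the open unit box from above its floor, so that it touches the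
floor in a Cantor set on which the functional `p` is injective. -/
theorem exists_homeomorph_touching_cantor {m : ℕ} {Z : Set (EuclideanSpace ℝ (Fin m) × ℝ)}
    (hZ : IsCompact Z) (p : EuclideanSpace ℝ (Fin m) →L[ℝ] ℝ)
    (hunc : ¬ ((fun z => p z.1) '' Z).Countable) :
    ∃ (H : EuclideanSpace ℝ (Fin m) × ℝ ≃ₜ EuclideanSpace ℝ (Fin m) × ℝ)
      (κ : (ℕ → Bool) → EuclideanSpace ℝ (Fin m)), Continuous κ ∧ Function.Injective (p ∘ κ) ∧
      (∀ z ∈ Z, (∀ i, (H z).1 i ∈ Ioo (0 : ℝ) 1) ∧ (H z).2 ∈ Ico (0 : ℝ) 1) ∧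
      ∀ x, (x, (0 : ℝ)) ∈ H '' Z ↔ x ∈ range κ := by
  have hp : Continuous fun z : EuclideanSpace ℝ (Fin m) × ℝ => p z.1 := by fun_prop
  obtain ⟨Y, hYZ, hY, hYunc, hYmin⟩ := hZ.exists_fiberwise_min hp continuous_snd hunc
  obtain ⟨K, hKY, hK, hKunc, hKq⟩ := hY.exists_fiberwise_const hp
    (q := fun (i : Fin m) z => z.1 i) (fun i => by fun_prop) hYunc Finset.univ
  have hinjK : InjOn (fun z : EuclideanSpace ℝ (Fin m) × ℝ => p z.1) K := fun x hx y hy hxy => by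
    refine Prod.ext ?_ ?_
    · ext i
      exact hKq i (Finset.mem_univ i) x hx y hy hxy
    · exact (hYmin x (hKY hx) y (hYZ (hKY hy)) hxy).antisymm
        (hYmin y (hKY hy) x (hYZ (hKY hx)) hxy.symm)
  obtain ⟨κ, hκ, hκinj, hκK⟩ := hK.exists_nat_bool_comp_injective hp hinjK hKunc
  obtain ⟨f, hf, hfκ, hfZ, hfeq⟩ := exists_continuous_support_from_below hZ hκ
    (fun c c' h => hκinj (congrArg p h))
    (fun c z hz h => hYmin _ (hKY (hκK c)) z hz (congrArg p h))
  obtain ⟨R, hR⟩ := (hZ.image (verticalShear f hf).continuous).isBounded.exists_norm_le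
  have hR1 : 0 < |R| + 1 := by positivity
  have hc : 0 < (2 * (|R| + 1))⁻¹ := by positivity
  set c := (2 * (|R| + 1))⁻¹ with hcdef
  have hbound : ∀ a, |a| ≤ R → |c * a| < 1 / 2 := fun a ha => by
    rw [abs_mul, abs_of_pos hc, hcdef, inv_mul_lt_iff₀ (by positivity)]
    linarith [le_abs_self R]
  let v : EuclideanSpace ℝ (Fin m) := WithLp.toLp 2 fun _ => 1 / 2
  have hH : ∀ z, ((verticalShear f hf).trans (scaleTranslate c hc.ne' v)) z =
      (c • z.1 + v, c * (z.2 - f z.1)) := fun z => scaleTranslate_apply _ _ _ _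
  refine ⟨(verticalShear f hf).trans (scaleTranslate c hc.ne' v), fun b => c • (κ b).1 + v,
    by fun_prop, fun b b' h => hκinj ?_, fun z hz => ?_, fun x => ⟨?_, ?_⟩⟩
  · simpa [hc.ne'] using h
  · have hz' := hR _ ⟨z, hz, rfl⟩
    have h1 : ‖z.1‖ ≤ R := (norm_fst_le (verticalShear f hf z)).trans hz'
    have h2 : |z.2 - f z.1| ≤ R := (norm_snd_le (verticalShear f hf z)).trans hz'
    rw [hH]
    refine ⟨fun i => ?_, ?_, ?_⟩
    · have h3 := abs_lt.1 (hbound (z.1 i) ((PiLp.norm_apply_le z.1 i).trans h1))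
      simp only [PiLp.add_apply, PiLp.smul_apply, smul_eq_mul, v, mem_Ioo]
      constructor <;> linarith [h3.1, h3.2]
    · exact mul_nonneg hc.le (sub_nonneg.2 (hfZ z hz))
    · dsimp only
      linarith [(abs_lt.1 (hbound _ h2)).2]
  · rintro ⟨z, hz, hzx⟩
    rw [hH, Prod.ext_iff] at hzx
    have h0 : f z.1 = z.2 := by
      have := (mul_eq_zero.1 hzx.2).resolve_left hc.ne'
      linarith
    obtain ⟨b, rfl⟩ := hfeq z hz h0
    exact ⟨b, hzx.1⟩
  · rintro ⟨b, rfl⟩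
    refine ⟨κ b, hYZ (hKY (hκK b)), ?_⟩
    rw [hH, hfκ, sub_self, mul_zero]

theorem mem_openFace_iff {m : ℕ} {x : EuclideanSpace ℝ (Fin (m + 1))} :
    x ∈ openFace (m + 1) ↔ (∀ i, (lastCoordHomeomorph m x).1 i ∈ Ioo (0 : ℝ) 1) ∧
      (lastCoordHomeomorph m x).2 = 0 := by
  refine and_congr ⟨fun h i => h i.castSucc i.2, fun h i hi => ?_⟩
    ⟨fun h => h _ rfl, fun h i hi => ?_⟩
  · exact h ⟨i, hi⟩
  · rwa [show i = Fin.last m from Fin.ext hi]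

/-- The projection of the open face to `ℝᵐ` is an open embedding. -/
theorem isOpenEmbedding_openFace (m : ℕ) :
    IsOpenEmbedding fun x : openFace (m + 1) => (lastCoordHomeomorph m x).1 := by
  have hg : Continuous fun x => (lastCoordHomeomorph m).symm (x, (0 : ℝ)) := by fun_prop
  refine ⟨IsEmbedding.of_comp (by fun_prop) hg ?_, ?_⟩
  · convert IsEmbedding.subtypeVal using 1
    ext1 x
    have h0 := (mem_openFace_iff.1 x.2).2
    rw [Function.comp_apply, Homeomorph.symm_apply_eq, ← h0]
  · convert isOpen_interior (s := unitCube m) using 1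
    rw [interior_unitCube]
    ext y
    refine ⟨?_, fun hy => ?_⟩
    · rintro ⟨x, rfl⟩
      exact (mem_openFace_iff.1 x.2).1
    · refine ⟨⟨(lastCoordHomeomorph m).symm (y, 0), mem_openFace_iff.2 ?_⟩, ?_⟩
      · simpa using hy
      · simp

/-- A Cantor set in the open face on which some linear functional is injective is cellularly
separated. -/
theorem isCellularlySeparated_openFace {m : ℕ} {κ : (ℕ → Bool) → EuclideanSpace ℝ (Fin m)}
    (hκ : Continuous κ) {p : EuclideanSpace ℝ (Fin m) →L[ℝ] ℝ} (hinj : Function.Injective (p ∘ κ))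
    {T : Set (openFace (m + 1))}
    (hT : (fun x : openFace (m + 1) => (lastCoordHomeomorph m x).1) '' T = range κ) :
    IsCellularlySeparated m T := by
  intro V hV hTV
  have hj := isOpenEmbedding_openFace m
  set j := fun x : openFace (m + 1) => (lastCoordHomeomorph m x).1 with hjdef
  have hd : Dense (p '' range κ)ᶜ := by
    rw [← interior_eq_empty_iff_dense_compl, ← range_comp]
    have hemb : IsEmbedding (p ∘ κ) :=
      (Continuous.isClosedEmbedding (by fun_prop) hinj).isEmbedding
    have htd : IsTotallyDisconnected (range (p ∘ κ)) :=
      hemb.isTotallyDisconnected_range.2 inferInstance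
    refine eq_empty_of_forall_notMem fun a ha => ?_
    obtain ⟨r, hr, hball⟩ := Metric.isOpen_iff.1 isOpen_interior a ha
    have hsub := htd _ (hball.trans interior_subset) (convex_ball a r).isPreconnected
    have h1 : a + r / 2 ∈ ball a r := by
      rw [mem_ball, Real.dist_eq, add_sub_cancel_left, abs_of_pos (by positivity)]
      linarith
    linarith [hsub (mem_ball_self hr) h1]
  have hinj' : InjOn p (range κ) := by
    rintro _ ⟨b, rfl⟩ _ ⟨b', rfl⟩ h
    rw [hinj h]
  obtain ⟨ι, B, hB, hcov, hdisj⟩ := (isCompact_range hκ).exists_separating_convex hinj' hd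
    (hj.isOpenMap V hV) (hT ▸ image_mono hTV)
  have hcl : ∀ i, closure (j ⁻¹' B i) = j ⁻¹' closure (B i) := fun i =>
    (hj.isOpenMap.preimage_closure_eq_closure_preimage hj.continuous _).symm
  have hrange : ∀ i, closure (B i) ⊆ range j := fun i =>
    (hB i).2.2.2.2.trans (image_subset_range _ _)
  have hhomeo : ∀ A ⊆ range j, Nonempty (↥(j ⁻¹' A) ≃ₜ A) := fun A hA =>
    ⟨(hj.isEmbedding.homeomorphImage _).trans
      (Homeomorph.setCongr (image_preimage_eq_of_subset hA))⟩
  refine ⟨ι, fun i => j ⁻¹' B i, fun i => (hB i).1.preimage hj.continuous, fun x hx => ?_,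
    iUnion_subset fun i => ?_, fun i => ?_, fun i => ?_, fun i i' hi => ?_⟩
  · rw [← preimage_iUnion]
    exact hcov (hT ▸ mem_image_of_mem j hx)
  · rw [hcl, ← hj.injective.preimage_image V]
    exact preimage_mono (hB i).2.2.2.2
  · obtain ⟨ho, hne, hc, hb, -⟩ := hB i
    obtain ⟨e⟩ := hhomeo (B i) (subset_closure.trans (hrange i))
    obtain ⟨e'⟩ := nonempty_homeomorph_of_convex ho hne hc hb
    exact ⟨e.trans e'⟩
  · obtain ⟨ho, hne, hc, hb, -⟩ := hB i
    obtain ⟨e⟩ := hhomeo _ (hrange i)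
    obtain ⟨e'⟩ := nonempty_closure_homeomorph_unitCube ho hne hc hb
    exact ⟨(Homeomorph.setCongr (hcl i)).trans (e.trans e')⟩
  · dsimp only
    rw [hcl, hcl]
    exact (hdisj i i' hi).preimage j

/-- After a permutation of coordinates, the first coordinate takes uncountably many values on a
given uncountable set. -/
theorem exists_homeomorph_uncountable_coord {k : ℕ} {X : Set (EuclideanSpace ℝ (Fin (k + 1)))}
    (hX : ¬ X.Countable) : ∃ σ : EuclideanSpace ℝ (Fin (k + 1)) ≃ₜ EuclideanSpace ℝ (Fin (k + 1)),
      ¬ ((fun x => x 0) '' (σ '' X)).Countable := by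
  obtain ⟨i, hi⟩ : ∃ i, ¬ ((fun x : EuclideanSpace ℝ (Fin (k + 1)) => x i) '' X).Countable := by
    by_contra! h
    have hpi := (countable_univ_pi h).preimage_of_injOn
      (f := fun x : EuclideanSpace ℝ (Fin (k + 1)) => (fun i => x i))
      (WithLp.ofLp_injective 2).injOn
    refine hX (hpi.mono fun x hx => ?_)
    rw [mem_preimage, mem_univ_pi]
    exact fun i => ⟨x, hx, rfl⟩
  refine ⟨(LinearIsometryEquiv.piLpCongrLeft 2 ℝ ℝ (Equiv.swap i 0)).toHomeomorph, ?_⟩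
  rw [image_image]
  simpa [LinearIsometryEquiv.piLpCongrLeft_apply, Equiv.piCongrLeft'] using hi

theorem isCantorSet_range {α : Type*} [TopologicalSpace α] [T2Space α] {κ : (ℕ → Bool) → α}
    (hκ : Continuous κ) (hinj : Function.Injective κ) : IsCantorSet (range κ) :=
  ⟨(hκ.isClosedEmbedding hinj).isEmbedding.toHomeomorph.symm.trans
    cantorSetHomeomorphNatToBool.symm⟩

/-- **Statement 5.4 (Frolkina).** Every non-empty perfect compact `X ⊆ ℝⁿ`, `n ≥ 2`, can be
moved by a self-homeomorphism of `ℝⁿ` into `Iⁿ` so that it meets `∂Iⁿ` in a Cantor set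
lying in `(0,1)^{n-1} × {0}` and cellularly separated there. -/
theorem into_cube_cellularly_separated_cantor_boundary (n : ℕ) (hn : 2 ≤ n)
    (X : Set (EuclideanSpace ℝ (Fin n))) (hne : X.Nonempty) (hperf : Perfect X)
    (hcpt : IsCompact X) :
    ∃ h : EuclideanSpace ℝ (Fin n) ≃ₜ EuclideanSpace ℝ (Fin n),
      h '' X ⊆ unitCube n ∧
      h '' X ∩ frontier (unitCube n) ⊆ openFace n ∧
      IsCantorSet (h '' X ∩ frontier (unitCube n)) ∧
      IsCellularlySeparated (n - 1)
        ((Subtype.val ⁻¹' (h '' X ∩ frontier (unitCube n))) : Set ↥(openFace n)) := by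
  obtain ⟨k, rfl⟩ : ∃ k, n = k + 2 := ⟨n - 2, by omega⟩
  have hX : ¬ X.Countable := by
    obtain ⟨g, hgX, -, hginj⟩ := hperf.exists_nat_bool_injection hne
    exact not_countable_of_nat_bool_injection hginj hgX
  obtain ⟨σ, hσ⟩ := exists_homeomorph_uncountable_coord hX
  let Φ := lastCoordHomeomorph (k + 1)
  let p : EuclideanSpace ℝ (Fin (k + 1)) →L[ℝ] ℝ := EuclideanSpace.proj 0
  obtain ⟨H, κ, hκ, hinj, hHZ, hH0⟩ := exists_homeomorph_touching_cantor
    (Z := Φ '' (σ '' X)) ((hcpt.image σ.continuous).image Φ.continuous) p (by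
      rw [image_image]
      exact hσ)
  let h := ((σ.trans Φ).trans H).trans Φ.symm
  have hΦh : ∀ x, Φ (h x) = H (Φ (σ x)) := fun x => Φ.apply_symm_apply _
  have hΦX : ∀ y ∈ h '' X, (∀ i, (Φ y).1 i ∈ Ioo (0 : ℝ) 1) ∧ (Φ y).2 ∈ Ico (0 : ℝ) 1 := by
    rintro _ ⟨x, hx, rfl⟩
    rw [hΦh]
    exact hHZ _ ⟨_, ⟨x, hx, rfl⟩, rfl⟩
  have hcube : h '' X ⊆ unitCube (k + 2) := fun y hy i => by
    obtain ⟨h1, h2⟩ := hΦX y hy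
    exact Fin.lastCases (Ico_subset_Icc_self h2) (fun i => Ioo_subset_Icc_self (h1 i)) i
  have hfront : ∀ y ∈ h '' X, (y ∈ frontier (unitCube (k + 2)) ↔ (Φ y).2 = 0) := fun y hy => by
    obtain ⟨h1, h2⟩ := hΦX y hy
    rw [(isClosed_unitCube _).frontier_eq, mem_sdiff, and_iff_right (hcube hy), interior_unitCube]
    refine ⟨fun hnot => by_contra fun hne0 => hnot fun i => ?_, fun h0 hmem => ?_⟩
    · exact Fin.lastCases ⟨h2.1.lt_of_ne' hne0, h2.2⟩ h1 i
    · exact (hmem (Fin.last _)).1.ne' h0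
  have hT : h '' X ∩ frontier (unitCube (k + 2)) = range fun c => Φ.symm (κ c, (0 : ℝ)) := by
    ext y
    constructor
    · rintro ⟨hy, hyf⟩
      have h0 := (hfront y hy).1 hyf
      obtain ⟨x, hx, rfl⟩ := hy
      obtain ⟨c, hc⟩ := (hH0 (Φ (h x)).1).1
        ⟨Φ (σ x), ⟨_, ⟨x, hx, rfl⟩, rfl⟩, by rw [← h0, ← hΦh]⟩
      exact ⟨c, by rw [Homeomorph.symm_apply_eq, hc, ← h0]⟩
    · rintro ⟨c, rfl⟩
      obtain ⟨_, ⟨_, ⟨x, hx, rfl⟩, rfl⟩, hz⟩ := (hH0 (κ c)).2 ⟨c, rfl⟩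
      have hy : Φ.symm (κ c, (0 : ℝ)) ∈ h '' X := ⟨x, hx, by rw [← hz]; rfl⟩
      exact ⟨hy, (hfront _ hy).2 (by simp)⟩
  have hface : h '' X ∩ frontier (unitCube (k + 2)) ⊆ openFace (k + 2) := fun y hy =>
    mem_openFace_iff.2 ⟨(hΦX y hy.1).1, (hfront y hy.1).1 hy.2⟩
  refine ⟨h, hcube, hface, ?_, isCellularlySeparated_openFace hκ hinj ?_⟩
  · rw [hT]
    refine isCantorSet_range (by fun_prop) fun c c' hc => hinj ?_
    have := congrArg Prod.fst (Φ.symm.injective hc)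
    exact congrArg p this
  · ext y
    constructor
    · rintro ⟨x, hx, rfl⟩
      rw [mem_preimage, hT] at hx
      obtain ⟨c, hc⟩ := hx
      refine ⟨c, ?_⟩
      change κ c = (Φ x).1
      rw [← hc, Homeomorph.apply_symm_apply]
    · rintro ⟨c, rfl⟩
      have hc : Φ.symm (κ c, (0 : ℝ)) ∈ h '' X ∩ frontier (unitCube (k + 2)) := hT ▸ ⟨c, rfl⟩
      refine ⟨⟨_, hface hc⟩, hc, ?_⟩
      change (Φ (Φ.symm (κ c, (0 : ℝ)))).1 = κ c
      rw [Homeomorph.apply_symm_apply]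

end
end
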